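/- Every Jordan arc in ℝ² can be mapped onto the segment [0,1] × {0} by a homeomorphism of ℝ² onto itself; equivalently, there are no wild arcs in the plane. -/

import Mathlib

open Set Metric

/-- A Jordan arc in a topological space: a homeomorphic copy of `[0,1]`. -/
def IsJordanArc {X : Type*} [TopologicalSpace X] (A : Set X) : Prop :=
  Nonempty (↥(Set.Icc (0:ℝ) 1) ≃ₜ ↥A)

namespace PlaneArc

open Filter Topology

/-- `f` has a continuous logarithm on `K`. -/
def HasLogOn (f : ℂ → ℂ) (K : Set ℂ) : Prop :=
  ∃ L : ℂ → ℂ, ContinuousOn L K ∧ ∀ z ∈ K, Complex.exp (L z) = f z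

lemma HasLogOn.mono {f : ℂ → ℂ} {K K' : Set ℂ} (h : HasLogOn f K) (hK : K' ⊆ K) :
    HasLogOn f K' := by
  obtain ⟨L, hL, hf⟩ := h
  exact ⟨L, hL.mono hK, fun z hz => hf z (hK hz)⟩

lemma HasLogOn.congr {f g : ℂ → ℂ} {K : Set ℂ} (h : HasLogOn f K) (hfg : EqOn g f K) :
    HasLogOn g K := by
  obtain ⟨L, hL, hf⟩ := h
  exact ⟨L, hL, fun z hz => (hf z hz).trans (hfg hz).symm⟩

lemma HasLogOn.mul {f g : ℂ → ℂ} {K : Set ℂ} (hf : HasLogOn f K) (hg : HasLogOn g K) :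
    HasLogOn (fun z => f z * g z) K := by
  obtain ⟨L, hL, hf⟩ := hf
  obtain ⟨M, hM, hg⟩ := hg
  exact ⟨fun z => L z + M z, hL.add hM, fun z hz => by rw [Complex.exp_add, hf z hz, hg z hz]⟩

lemma HasLogOn.inv {f : ℂ → ℂ} {K : Set ℂ} (hf : HasLogOn f K) :
    HasLogOn (fun z => (f z)⁻¹) K := by
  obtain ⟨L, hL, hf⟩ := hf
  exact ⟨fun z => -L z, hL.neg, fun z hz => by rw [Complex.exp_neg, hf z hz]⟩

lemma HasLogOn.div {f g : ℂ → ℂ} {K : Set ℂ} (hf : HasLogOn f K) (hg : HasLogOn g K) :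
    HasLogOn (fun z => f z / g z) K := by
  simpa only [div_eq_mul_inv] using hf.mul hg.inv

lemma HasLogOn.comp {f g : ℂ → ℂ} {K K' : Set ℂ} (hf : HasLogOn f K')
    (hg : ContinuousOn g K) (hgK : MapsTo g K K') : HasLogOn (fun z => f (g z)) K := by
  obtain ⟨L, hL, hf⟩ := hf
  exact ⟨fun z => L (g z), hL.comp hg hgK, fun z hz => hf _ (hgK hz)⟩

lemma hasLogOn_const {c : ℂ} (hc : c ≠ 0) (K : Set ℂ) : HasLogOn (fun _ => c) K :=
  ⟨fun _ => Complex.log c, continuousOn_const, fun _ _ => Complex.exp_log hc⟩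

lemma hasLogOn_of_slitPlane {f : ℂ → ℂ} {K : Set ℂ} (hf : ContinuousOn f K)
    (h : ∀ z ∈ K, f z ∈ Complex.slitPlane) : HasLogOn f K :=
  ⟨fun z => Complex.log (f z), hf.clog h,
    fun z hz => Complex.exp_log (Complex.slitPlane_ne_zero (h z hz))⟩

lemma hasLogOn_of_norm_sub_one_lt {f : ℂ → ℂ} {K : Set ℂ} (hf : ContinuousOn f K)
    (h : ∀ z ∈ K, ‖f z - 1‖ < 1) : HasLogOn f K :=
  hasLogOn_of_slitPlane hf fun z hz => by
    have := Complex.mem_slitPlane_of_norm_lt_one (h z hz)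
    simpa using this

lemma hasLogOn_univ {f : ℂ → ℂ} (hf : Continuous f) (h : ∀ z, f z ≠ 0) : HasLogOn f univ := by
  have hU : IsSimplyConnected (univ : Set ℂ) := by
    have : SimplyConnectedSpace ℂ := inferInstance
    exact (Homeomorph.Set.univ ℂ).toHomotopyEquiv.simplyConnectedSpace
  obtain ⟨L, hL, hf⟩ := Complex.exists_continuousOn_eqOn_exp_comp hU isOpen_univ
    hf.continuousOn (by simpa using h)
  exact ⟨L, hL, fun z hz => hf hz⟩

/-- Two continuous logarithms of the same function on a preconnected set differ by a constant. -/
lemma exists_const_of_exp_eq {K : Set ℂ} (hK : IsPreconnected K) {L M : ℂ → ℂ}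
    (hL : ContinuousOn L K) (hM : ContinuousOn M K)
    (h : ∀ z ∈ K, Complex.exp (L z) = Complex.exp (M z)) :
    ∃ c : ℂ, Complex.exp c = 1 ∧ ∀ z ∈ K, L z = M z + c := by
  rcases K.eq_empty_or_nonempty with rfl | ⟨z₀, hz₀⟩
  · exact ⟨0, by simp, by simp⟩
  have hperiod : ∀ z ∈ K, ∃ n : ℤ, L z - M z = n * (2 * Real.pi * Complex.I) := fun z hz => by
    obtain ⟨n, hn⟩ := Complex.exp_eq_exp_iff_exists_int.1 (h z hz)
    exact ⟨n, by rw [hn]; ring⟩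
  have hpi : (2 * Real.pi * Complex.I : ℂ) ≠ 0 := Complex.two_pi_I_ne_zero
  let F : ℂ → ℝ := fun z => ((L z - M z) / (2 * Real.pi * Complex.I)).re
  have hF : ContinuousOn F K :=
    Complex.continuous_re.comp_continuousOn ((hL.sub hM).div_const _)
  have hFint : MapsTo F K (range ((↑) : ℤ → ℝ)) := by
    intro z hz
    obtain ⟨n, hn⟩ := hperiod z hz
    exact ⟨n, by simp only [F]; rw [hn, mul_div_cancel_right₀ _ hpi]; simp⟩
  have hconst : ∀ z ∈ K, F z = F z₀ := by
    intro z hz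
    have hd : DiscreteTopology (range ((↑) : ℤ → ℝ)) :=
      (Int.isClosedEmbedding_coe_real.isEmbedding.toHomeomorph.symm).isEmbedding.discreteTopology
    exact hK.constant_of_mapsTo ⟨hd⟩ hF hFint hz hz₀
  refine ⟨L z₀ - M z₀, by rw [Complex.exp_sub, h z₀ hz₀, div_self (Complex.exp_ne_zero _)],
    fun z hz => ?_⟩
  obtain ⟨n, hn⟩ := hperiod z hz
  obtain ⟨m, hm⟩ := hperiod z₀ hz₀
  have := hconst z hz
  simp only [F] at this
  rw [hn, hm, mul_div_cancel_right₀ _ hpi, mul_div_cancel_right₀ _ hpi] at this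
  have : n = m := by simpa using this
  subst this
  rw [← sub_eq_iff_eq_add', hn, hm]

lemma HasLogOn.union {f : ℂ → ℂ} {K₁ K₂ : Set ℂ} (h₁ : HasLogOn f K₁) (h₂ : HasLogOn f K₂)
    (hc₁ : IsClosed K₁) (hc₂ : IsClosed K₂) (hK : IsPreconnected (K₁ ∩ K₂)) :
    HasLogOn f (K₁ ∪ K₂) := by
  classical
  obtain ⟨L, hL, hLf⟩ := h₁
  obtain ⟨M, hM, hMf⟩ := h₂
  obtain ⟨c, hc, hLM⟩ := exists_const_of_exp_eq hK (hL.mono inter_subset_left)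
    (hM.mono inter_subset_right) fun z hz => by rw [hLf z hz.1, hMf z hz.2]
  let N : ℂ → ℂ := fun z => if z ∈ K₁ then L z else M z + c
  have e₁ : EqOn N L K₁ := fun z hz => by simp [N, hz]
  have e₂ : EqOn N (fun z => M z + c) K₂ := fun z hz => by
    by_cases h : z ∈ K₁
    · simp only [N, h, if_true]; exact hLM z ⟨h, hz⟩
    · simp [N, h]
  refine ⟨N, (hL.congr e₁).union_of_isClosed ((hM.add continuousOn_const).congr e₂) hc₁ hc₂, ?_⟩
  rintro z (hz | hz)
  · rw [e₁ hz, hLf z hz]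
  · rw [e₂ hz, Complex.exp_add, hc, mul_one, hMf z hz]

/-- Logarithms descend along an injective continuous map of a compact set. -/
lemma HasLogOn.image {f g : ℂ → ℂ} {K : Set ℂ} (hK : IsCompact K) (hg : ContinuousOn g K)
    (hinj : InjOn g K) (h : HasLogOn (fun z => f (g z)) K) : HasLogOn f (g '' K) := by
  obtain ⟨L, hL, hLf⟩ := h
  have hleft : ∀ z ∈ K, Function.invFunOn g K (g z) = z := fun z hz => hinj.leftInvOn_invFunOn hz
  refine ⟨fun w => L (Function.invFunOn g K w), ?_, ?_⟩
  · refine hL.comp ?_ ?_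
    · rw [continuousOn_iff_isClosed]
      intro t ht
      refine ⟨g '' (t ∩ K), ((hK.inter_left ht).image_of_continuousOn
        (hg.mono inter_subset_right)).isClosed, ?_⟩
      ext w
      constructor
      · rintro ⟨hw, z, hz, rfl⟩
        exact ⟨⟨z, ⟨by simpa [hleft z hz] using hw, hz⟩, rfl⟩, mem_image_of_mem _ hz⟩
      · rintro ⟨⟨z, hz, rfl⟩, hw⟩
        exact ⟨by simpa [hleft z hz.2] using hz.1, hw⟩
    · rintro _ ⟨z, hz, rfl⟩
      rwa [hleft z hz]
  · rintro _ ⟨z, hz, rfl⟩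
    simp only [hleft z hz, hLf z hz]

lemma not_hasLogOn_sphere (p : ℂ) {r : ℝ} (hr : 0 < r) :
    ¬ HasLogOn (fun z => z - p) (sphere p r) := by
  rintro ⟨L, hL, hLf⟩
  have hc : Continuous fun z : ℂ => L (circleMap p r z.re) :=
    hL.comp_continuous ((continuous_circleMap p r).comp Complex.continuous_re)
      fun z => circleMap_mem_sphere _ hr.le _
  have hM : Continuous fun z : ℂ => (Real.log r : ℂ) + z.re * Complex.I := by fun_prop
  obtain ⟨c, -, h⟩ := exists_const_of_exp_eq (isPreconnected_univ (α := ℂ)) hc.continuousOn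
    hM.continuousOn fun z _ => by
      rw [hLf _ (circleMap_mem_sphere _ hr.le _), Complex.exp_add, ← Complex.ofReal_exp,
        Real.exp_log hr]
      simp [circleMap]
  have h0 := h 0 (mem_univ _)
  have h1 := h (2 * Real.pi : ℝ) (mem_univ _)
  have : circleMap p r (2 * Real.pi) = circleMap p r 0 := by
    simpa using periodic_circleMap p r 0
  simp only [Complex.ofReal_re, this, Complex.zero_re] at h0 h1
  rw [h0] at h1
  have : (2 * Real.pi * Complex.I : ℂ) = 0 := by
    push_cast at h1
    linear_combination -h1
  exact Complex.two_pi_I_ne_zero this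

/-- `p` and `q` lie in a connected subset of the complement of `K`. -/
def JoinedOff (K : Set ℂ) (p q : ℂ) : Prop :=
  ∃ C, IsPreconnected C ∧ C ⊆ Kᶜ ∧ p ∈ C ∧ q ∈ C

lemma JoinedOff.symm {K : Set ℂ} {p q : ℂ} (h : JoinedOff K p q) : JoinedOff K q p := by
  obtain ⟨C, h1, h2, h3, h4⟩ := h
  exact ⟨C, h1, h2, h4, h3⟩

lemma JoinedOff.trans {K : Set ℂ} {p q r : ℂ} (h : JoinedOff K p q) (h' : JoinedOff K q r) :
    JoinedOff K p r := by
  obtain ⟨C, h1, h2, h3, h4⟩ := h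
  obtain ⟨D, k1, k2, k3, k4⟩ := h'
  exact ⟨C ∪ D, h1.union q h4 k3 k1, union_subset h2 k2, .inl h3, .inr k4⟩

lemma JoinedOff.hasLogOn {K : Set ℂ} (hK : IsCompact K) {p q : ℂ} (h : JoinedOff K p q) :
    HasLogOn (fun z => (z - p) / (z - q)) K := by
  obtain ⟨C, hC, hCK, hp, hq⟩ := h
  refine hC.induction₂ (fun p q => HasLogOn (fun z => (z - p) / (z - q)) K) ?_ ?_ ?_ hp hq
  · intro x hx
    have hxK : x ∈ Kᶜ := hCK hx
    obtain ⟨ε, hε, hball⟩ := Metric.isOpen_iff.1 hK.isClosed.isOpen_compl x hxK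
    have hnear : ∀ᶠ y in 𝓝[C] x, y ∈ ball x (ε / 2) :=
      mem_nhdsWithin_of_mem_nhds (ball_mem_nhds x (by positivity))
    filter_upwards [hnear, self_mem_nhdsWithin] with y hy hyC
    have hyK : ∀ z ∈ K, z - y ≠ 0 := fun z hz h => hCK hyC (sub_eq_zero.1 h ▸ hz)
    refine hasLogOn_of_norm_sub_one_lt ?_ ?_
    · exact (continuousOn_id.sub continuousOn_const).div (continuousOn_id.sub continuousOn_const)
        hyK
    · intro z hz
      have h1 : (z - x) / (z - y) - 1 = (y - x) / (z - y) := by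
        field_simp [hyK z hz]; ring
      have h2 : ε ≤ dist z x := by
        by_contra! h
        exact hball (mem_ball.2 h) hz
      have h3 : dist y x < ε / 2 := hy
      have h4 : dist z x ≤ dist z y + dist y x := dist_triangle _ _ _
      rw [h1, norm_div, div_lt_one (norm_pos_iff.2 (hyK z hz)), ← dist_eq_norm, ← dist_eq_norm]
      linarith
  · intro x y z _ hy _ hxy hyz
    refine (hxy.mul hyz).congr fun w hw => ?_
    have : w - y ≠ 0 := fun h => hCK hy (sub_eq_zero.1 h ▸ hw)
    simp only
    rw [div_mul_div_cancel₀ this]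
  · intro x y _ _ h
    exact h.inv.congr fun w _ => by simp

lemma isPreconnected_compl_closedBall (r : ℝ) : IsPreconnected (closedBall (0 : ℂ) r)ᶜ := by
  have hr : closedBall (0 : ℂ) r = closedBall 0 r := rfl
  have : (closedBall (0 : ℂ) r)ᶜ =
      (fun x : ℝ × ℝ => (x.1 : ℂ) * Complex.exp (x.2 * Complex.I)) ''
          ((Ioi r ∩ Ici 0) ×ˢ univ) := by
    ext z
    simp only [mem_compl_iff, mem_closedBall, dist_zero_right, not_le]
    constructor
    · intro hz
      exact ⟨(‖z‖, z.arg), ⟨⟨hz, norm_nonneg _⟩, mem_univ _⟩, Complex.norm_mul_exp_arg_mul_I z⟩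
    · rintro ⟨⟨s, θ⟩, ⟨⟨hs, hs0⟩, -⟩, rfl⟩
      simp only [norm_mul, Complex.norm_exp_ofReal_mul_I, mul_one, Complex.norm_real,
        Real.norm_eq_abs]
      exact lt_of_lt_of_le hs (le_abs_self _)
  rw [this]
  refine IsPreconnected.image ?_ _ (by fun_prop)
  exact (((ordConnected_Ioi.inter ordConnected_Ici).isPreconnected).prod isPreconnected_univ)

lemma frontier_connectedComponentIn_subset {K : Set ℂ} (hK : IsClosed K) (p : ℂ) :
    frontier (connectedComponentIn Kᶜ p) ⊆ K := by
  intro x hx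
  by_contra hxK
  rw [(hK.isOpen_compl.connectedComponentIn).frontier_eq] at hx
  have hne : p ∈ Kᶜ := by
    by_contra h
    rw [connectedComponentIn_eq_empty h] at hx
    simp at hx
  refine hx.2 (IsPreconnected.subset_connectedComponentIn
    (s := insert x (connectedComponentIn Kᶜ p)) ?_ ?_ ?_ (mem_insert _ _))
  · exact isPreconnected_connectedComponentIn.subset_closure (subset_insert _ _)
      (insert_subset hx.1 subset_closure)
  · exact mem_insert_of_mem _ (mem_connectedComponentIn hne)
  · exact insert_subset hxK (connectedComponentIn_subset _ _)

lemma exists_continuous_extension {K : Set ℂ} (hK : IsClosed K) {L : ℂ → ℂ}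
    (hL : ContinuousOn L K) : ∃ M : ℂ → ℂ, Continuous M ∧ EqOn M L K := by
  obtain ⟨g, hg⟩ := ContinuousMap.exists_restrict_eq hK
    (⟨K.domRestrict L, continuousOn_iff_continuous_domRestrict.1 hL⟩ : C(K, ℂ))
  exact ⟨g, g.continuous, fun z hz => DFunLike.congr_fun hg ⟨z, hz⟩⟩

lemma not_hasLogOn_of_isBounded {K : Set ℂ} (hK : IsClosed K) {p q : ℂ} (hp : p ∉ K)
    (hq : q ∉ K) (hb : Bornology.IsBounded (connectedComponentIn Kᶜ p))
    (hqO : q ∉ connectedComponentIn Kᶜ p) :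
    ¬ HasLogOn (fun z => (z - p) / (z - q)) K := by
  classical
  rintro ⟨L, hL, hLf⟩
  obtain ⟨M, hM, hML⟩ := exists_continuous_extension hK hL
  set O := connectedComponentIn Kᶜ p with hO
  have hpO : p ∈ O := mem_connectedComponentIn hp
  let G : ℂ → ℂ := fun z => if z ∈ O then Complex.exp (M z) * (z - q) else z - p
  have hG : Continuous G := by
    refine continuous_if ?_ ?_ ?_
    · intro z hz
      have hzK : z ∈ K := frontier_connectedComponentIn_subset hK p hz
      have hzq : z - q ≠ 0 := fun h => hq (sub_eq_zero.1 h ▸ hzK)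
      rw [hML hzK, hLf z hzK, div_mul_cancel₀ _ hzq]
    · exact ((Complex.continuous_exp.comp hM).mul (continuous_id.sub continuous_const)).continuousOn
    · exact (continuous_id.sub continuous_const).continuousOn
  have hG0 : ∀ z, G z ≠ 0 := by
    intro z
    by_cases h : z ∈ O
    · simp only [G, h, if_true]
      exact mul_ne_zero (Complex.exp_ne_zero _) fun h' => hqO (sub_eq_zero.1 h' ▸ h)
    · simp only [G, h, if_false]
      exact fun h' => h (sub_eq_zero.1 h' ▸ hpO)
  obtain ⟨r, hr⟩ := hb.subset_ball p
  have hr0 : 0 < r := pos_of_mem_ball (hr hpO)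
  refine not_hasLogOn_sphere p hr0 (((hasLogOn_univ hG hG0).mono (subset_univ _)).congr ?_)
  intro z hz
  have : z ∉ O := fun h => by
    have := hr h
    rw [mem_ball, mem_sphere.1 hz] at this
    exact lt_irrefl _ this
  simp [G, this]

lemma subset_connectedComponentIn_of_not_isBounded {O : Set ℂ} {U : Set ℂ} {p : ℂ} {r : ℝ}
    (hO : O = connectedComponentIn U p) (hU : Uᶜ ⊆ closedBall 0 r)
    (hb : ¬ Bornology.IsBounded O) : (closedBall 0 r)ᶜ ⊆ O := by
  have : ¬ O ⊆ closedBall 0 r := fun h => hb (isBounded_closedBall.subset h)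
  obtain ⟨x, hxO, hx⟩ := not_subset.1 this
  subst hO
  rw [connectedComponentIn_eq hxO]
  exact (isPreconnected_compl_closedBall r).subset_connectedComponentIn hx
    (compl_subset_comm.1 hU)

/-- Eilenberg's criterion: if `(z - p) / (z - q)` has a logarithm on `K`, then `K` does not
separate `p` from `q`. -/
lemma HasLogOn.joinedOff {K : Set ℂ} (hK : IsCompact K) {p q : ℂ} (hp : p ∉ K) (hq : q ∉ K)
    (h : HasLogOn (fun z => (z - p) / (z - q)) K) : JoinedOff K p q := by
  by_cases hqO : q ∈ connectedComponentIn Kᶜ p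
  · exact ⟨_, isPreconnected_connectedComponentIn, connectedComponentIn_subset _ _,
      mem_connectedComponentIn hp, hqO⟩
  exfalso
  have hpO : p ∉ connectedComponentIn Kᶜ q := fun h' => hqO <| by
    rw [← connectedComponentIn_eq h']
    exact mem_connectedComponentIn hq
  have h' : HasLogOn (fun z => (z - q) / (z - p)) K := h.inv.congr fun z _ => by simp
  have hb := mt (fun hb => not_hasLogOn_of_isBounded hK.isClosed hp hq hb hqO) (not_not.2 h)
  have hb' := mt (fun hb => not_hasLogOn_of_isBounded hK.isClosed hq hp hb hpO) (not_not.2 h')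
  obtain ⟨r, hr⟩ := hK.isBounded.subset_closedBall 0
  have hs := subset_connectedComponentIn_of_not_isBounded (p := p) rfl
    ((compl_compl K).le.trans hr) hb
  have hs' := subset_connectedComponentIn_of_not_isBounded (p := q) rfl
    ((compl_compl K).le.trans hr) hb'
  have hx : ((|r| + 1 : ℝ) : ℂ) ∈ (closedBall (0 : ℂ) r)ᶜ := by
    simp only [mem_compl_iff, mem_closedBall, dist_zero_right, Complex.norm_real,
      Real.norm_eq_abs, not_le]
    rw [abs_of_pos (by positivity)]
    linarith [le_abs_self r]
  apply hqO
  rw [connectedComponentIn_eq (hs hx), ← connectedComponentIn_eq (hs' hx)]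
  exact mem_connectedComponentIn hq

/-- Janiszewski's theorem. -/
lemma JoinedOff.union {K₁ K₂ : Set ℂ} (h₁ : IsCompact K₁) (h₂ : IsCompact K₂)
    (hK : IsPreconnected (K₁ ∩ K₂)) {p q : ℂ} (hj₁ : JoinedOff K₁ p q) (hj₂ : JoinedOff K₂ p q) :
    JoinedOff (K₁ ∪ K₂) p q := by
  have hp : p ∉ K₁ ∪ K₂ := by
    obtain ⟨C, -, h, hp, -⟩ := hj₁
    obtain ⟨D, -, h', hp', -⟩ := hj₂
    exact fun hpp => hpp.elim (h hp) (h' hp')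
  have hq : q ∉ K₁ ∪ K₂ := by
    obtain ⟨C, -, h, -, hp⟩ := hj₁
    obtain ⟨D, -, h', -, hp'⟩ := hj₂
    exact fun hpp => hpp.elim (h hp) (h' hp')
  exact HasLogOn.joinedOff (h₁.union h₂) hp hq
    ((hj₁.hasLogOn h₁).union (hj₂.hasLogOn h₂) h₁.isClosed h₂.isClosed hK)

lemma JoinedOff.subset_of_isOpen {K : Set ℂ} {p q : ℂ} (h : JoinedOff K p q) {U W : Set ℂ}
    (hU : IsOpen U) (hW : IsOpen W) (hUW : Disjoint U W) (hK : Kᶜ ⊆ U ∪ W) (hp : p ∈ U) :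
    q ∈ U := by
  obtain ⟨C, hC, hCK, hpC, hqC⟩ := h
  exact hC.subset_left_of_subset_union hU hW hUW (hCK.trans hK) ⟨p, hpC, hp⟩ hqC

/-- The complement of `K` is connected iff every `z - p`, `p ∉ K`, has a logarithm on `K`. -/
lemma hasLogOn_sub_of_isPreconnected_compl {K : Set ℂ} (hK : IsCompact K)
    (hKc : IsPreconnected Kᶜ) {p : ℂ} (hp : p ∉ K) : HasLogOn (fun z => z - p) K := by
  obtain ⟨r, hr⟩ := hK.isBounded.subset_closedBall 0
  set q : ℂ := ((|r| + 1 : ℝ) : ℂ) with hq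
  have hre : ∀ z ∈ K, 0 < (q - z).re := fun z hz => by
    have h1 : ‖z‖ ≤ r := by simpa using hr hz
    have h2 := (Complex.abs_re_le_norm z).trans h1
    have h3 := le_abs_self z.re
    have h4 := le_abs_self r
    rw [Complex.sub_re, hq, Complex.ofReal_re]
    linarith
  have hqK : q ∉ K := fun h => by simpa using hre q h
  have h1 : HasLogOn (fun z => (z - p) / (z - q)) K :=
    JoinedOff.hasLogOn hK ⟨Kᶜ, hKc, subset_rfl, hp, hqK⟩
  have h2 : HasLogOn (fun z => q - z) K :=
    hasLogOn_of_slitPlane (by fun_prop) fun z hz => .inl (hre z hz)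
  refine ((h1.mul h2).mul (hasLogOn_const (c := -1) (by norm_num) K)).congr fun z hz => ?_
  have : z - q ≠ 0 := fun h => hqK (sub_eq_zero.1 h ▸ hz)
  field_simp
  ring

lemma isPreconnected_compl_of_hasLogOn {K : Set ℂ} (hK : IsCompact K)
    (h : ∀ p ∉ K, HasLogOn (fun z => z - p) K) : IsPreconnected Kᶜ := by
  refine isPreconnected_of_forall_pair fun p hp q hq => ?_
  obtain ⟨C, h1, h2, h3, h4⟩ := HasLogOn.joinedOff hK hp hq ((h p hp).div (h q hq))
  exact ⟨C, h2, h3, h4, h1⟩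

end PlaneArc

namespace PlaneArc

open Filter Topology

lemma isOpen_sq_image {U : Set ℂ} (hU : IsOpen U) : IsOpen ((fun w : ℂ => w ^ 2) '' U) := by
  have h : AnalyticOnNhd ℂ (fun w : ℂ => w ^ 2) univ := fun z _ => by fun_prop
  rcases h.is_constant_or_isOpen isPreconnected_univ with ⟨w, hw⟩ | h
  · have h0 := hw 0 (mem_univ _)
    have h1 := hw 1 (mem_univ _)
    simp at h0 h1
    exact absurd (h0.trans h1.symm) (by norm_num)
  · exact h U (subset_univ _) hU

lemma isPreconnected_sq_preimage {U : Set ℂ} (hU : IsOpen U) (hUc : IsPreconnected U)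
    (h0 : (0 : ℂ) ∈ U) : IsPreconnected ((fun w : ℂ => w ^ 2) ⁻¹' U) := by
  set Q := (fun w : ℂ => w ^ 2) ⁻¹' U with hQ
  have hQo : IsOpen Q := hU.preimage (by fun_prop)
  have hQ0 : (0 : ℂ) ∈ Q := by simpa [hQ] using h0
  set C := connectedComponentIn Q 0 with hC
  have hC0 : (0 : ℂ) ∈ C := mem_connectedComponentIn hQ0
  have hCQ : C ⊆ Q := connectedComponentIn_subset _ _
  have hCneg : ∀ x ∈ C, -x ∈ C := fun x hx => by
    have h1 : IsPreconnected ((fun x => -x) '' C) :=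
      isPreconnected_connectedComponentIn.image _ continuous_neg.continuousOn
    refine h1.subset_connectedComponentIn ⟨0, hC0, neg_zero⟩ ?_ ⟨x, hx, rfl⟩
    rintro _ ⟨y, hy, rfl⟩
    simpa [hQ] using hCQ hy
  have hD : IsOpen (Q \ C) := by
    rw [isOpen_iff_mem_nhds]
    intro x hx
    refine mem_of_superset
      ((hQo.connectedComponentIn).mem_nhds (mem_connectedComponentIn hx.1)) fun y hy => ?_
    refine ⟨connectedComponentIn_subset _ _ hy, fun hyC => hx.2 ?_⟩
    rw [hC, connectedComponentIn_eq hyC, ← connectedComponentIn_eq hy]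
    exact mem_connectedComponentIn hx.1
  have hCo : IsOpen C := hQo.connectedComponentIn
  suffices h : Q ⊆ C by
    rw [subset_antisymm h hCQ]; exact isPreconnected_connectedComponentIn
  have hdisj : Disjoint ((fun w : ℂ => w ^ 2) '' C) ((fun w : ℂ => w ^ 2) '' (Q \ C)) := by
    rw [Set.disjoint_left]
    rintro _ ⟨x, hx, rfl⟩ ⟨y, hy, hxy⟩
    rcases sq_eq_sq_iff_eq_or_eq_neg.1 hxy with rfl | rfl
    · exact hy.2 hx
    · exact hy.2 (hCneg x hx)
  have hcov : U ⊆ (fun w : ℂ => w ^ 2) '' C ∪ (fun w : ℂ => w ^ 2) '' (Q \ C) := by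
    intro u hu
    obtain ⟨w, rfl⟩ : ∃ w : ℂ, w ^ 2 = u := IsAlgClosed.exists_pow_nat_eq u (by norm_num)
    by_cases h : w ∈ C
    · exact .inl ⟨w, h, rfl⟩
    · exact .inr ⟨w, ⟨hu, h⟩, rfl⟩
  have hUC := hUc.subset_left_of_subset_union (isOpen_sq_image hCo) (isOpen_sq_image hD) hdisj hcov
    ⟨0, h0, 0, hC0, by simp⟩
  intro x hx
  by_contra hxC
  exact Set.disjoint_left.1 hdisj (hUC hx) ⟨x, ⟨hx, hxC⟩, rfl⟩

/-- A compact set `S` not meeting `-S` whose square does not separate the plane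
does not separate the plane. -/
lemma isPreconnected_compl_of_sq {S : Set ℂ} (hS : IsCompact S) (hneg : ∀ x ∈ S, -x ∉ S)
    (h : IsPreconnected ((fun w : ℂ => w ^ 2) '' S)ᶜ) : IsPreconnected Sᶜ := by
  have h0S : (0 : ℂ) ∉ S := fun h => by simpa [h] using hneg 0 h
  have h0 : (0 : ℂ) ∈ ((fun w : ℂ => w ^ 2) '' S)ᶜ := by
    rintro ⟨x, hx, hx0⟩
    have : x = 0 := by simpa using hx0
    exact h0S (this ▸ hx)
  have hQ := isPreconnected_sq_preimage
    (hS.image (by fun_prop : Continuous fun w : ℂ => w ^ 2)).isClosed.isOpen_compl h h0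
  set Q := (fun w : ℂ => w ^ 2) ⁻¹' ((fun w : ℂ => w ^ 2) '' S)ᶜ with hQdef
  have hQS : Q ⊆ Sᶜ := fun x hx hxS => hx ⟨x, hxS, rfl⟩
  have hnQ : ∀ x, x ∉ Q → x ∉ S → -x ∈ S := by
    intro x hxQ hxS
    obtain ⟨y, hy, hyx⟩ : x ^ 2 ∈ (fun w : ℂ => w ^ 2) '' S := not_not.1 hxQ
    rcases sq_eq_sq_iff_eq_or_eq_neg.1 hyx with rfl | rfl
    · exact absurd hy hxS
    · exact hy
  have hj : ∀ p ∈ Sᶜ, JoinedOff S p 0 := by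
    intro p hp
    by_cases hmeet : ∃ x ∈ connectedComponentIn Sᶜ p, x ∈ Q
    · obtain ⟨x, hx, hxQ⟩ := hmeet
      exact JoinedOff.trans ⟨_, isPreconnected_connectedComponentIn,
        connectedComponentIn_subset _ _, mem_connectedComponentIn hp, hx⟩
        ⟨Q, hQ, hQS, hxQ, by simpa [hQdef] using h0⟩
    exfalso
    push Not at hmeet
    have hO : connectedComponentIn Sᶜ p ⊆ (fun x => -x) ⁻¹' S := fun x hx =>
      hnQ x (hmeet x hx) (connectedComponentIn_subset _ _ hx)
    have hcl : closure (connectedComponentIn Sᶜ p) ⊆ (fun x => -x) ⁻¹' S :=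
      closure_minimal hO (hS.isClosed.preimage continuous_neg)
    have hfr : frontier (connectedComponentIn Sᶜ p) = ∅ := by
      rw [eq_empty_iff_forall_notMem]
      intro x hx
      exact hneg x (frontier_connectedComponentIn_subset hS.isClosed p hx)
        (hcl (frontier_subset_closure hx))
    rcases isClopen_iff.1 (isClopen_iff_frontier_eq_empty.2 hfr) with h | h
    · have := mem_connectedComponentIn hp
      rw [h] at this; exact this
    · have : (0 : ℂ) ∈ connectedComponentIn Sᶜ p := h ▸ mem_univ _
      have := hO this
      simp [h0S] at this
  refine isPreconnected_of_forall 0 fun p hp => ?_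
  obtain ⟨C, h1, h2, h3, h4⟩ := hj p hp
  exact ⟨C, h2, h4, h3, h1⟩

/-- The restrictions of `f - c` to non-separating compact subsets of `V` have logarithms. -/
def LogClass (V : Set ℂ) (f : ℂ → ℂ) : Prop :=
  ∀ K ⊆ V, IsCompact K → IsPreconnected Kᶜ → ∀ c ∉ f '' K, HasLogOn (fun z => f z - c) K

lemma logClass_id (V : Set ℂ) : LogClass V id := fun K _ hK hKc c hc =>
  hasLogOn_sub_of_isPreconnected_compl hK hKc (by simpa using hc)

lemma LogClass.hasLogOn {V : Set ℂ} {f : ℂ → ℂ} (hf : LogClass V f) {K : Set ℂ} (hKV : K ⊆ V)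
    (hK : IsCompact K) (hKc : IsPreconnected Kᶜ) {a b : ℂ} (h : ∀ z ∈ K, a * f z + b ≠ 0) :
    HasLogOn (fun z => a * f z + b) K := by
  rcases K.eq_empty_or_nonempty with rfl | ⟨z₀, hz₀⟩
  · exact ⟨0, continuousOn_const, by simp⟩
  by_cases ha : a = 0
  · subst ha
    have hb : b ≠ 0 := by simpa using h z₀ hz₀
    exact (hasLogOn_const hb K).congr fun z _ => by simp
  · have : -(b / a) ∉ f '' K := by
      rintro ⟨z, hz, hzb⟩
      exact h z hz (by rw [hzb]; field_simp; ring)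
    exact ((hasLogOn_const ha K).mul (hf K hKV hK hKc _ this)).congr fun z _ => by
      field_simp; ring

lemma LogClass.moebius {V : Set ℂ} {f : ℂ → ℂ} (hf : LogClass V f) {a b c d : ℂ}
    (h : ∀ z ∈ V, c * f z + d ≠ 0) : LogClass V fun z => (a * f z + b) / (c * f z + d) := by
  intro K hKV hK hKc e he
  have hden := hf.hasLogOn hKV hK hKc fun z hz => h z (hKV hz)
  have hnum := hf.hasLogOn (a := a - e * c) (b := b - e * d) hKV hK hKc fun z hz h0 => he ⟨z, hz, by
    simp only
    rw [div_eq_iff (h z (hKV hz))]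
    linear_combination h0⟩
  refine (hnum.div hden).congr fun z hz => ?_
  simp only
  rw [eq_div_iff (h z (hKV hz)), sub_mul, div_mul_cancel₀ _ (h z (hKV hz))]
  ring

lemma LogClass.sqrt {V : Set ℂ} {s : ℂ → ℂ} (hs : ContinuousOn s V)
    (hinj : InjOn (fun z => s z ^ 2) V) (h0 : ∀ z ∈ V, s z ≠ 0)
    (hf : LogClass V fun z => s z ^ 2) : LogClass V s := by
  intro K hKV hK hKc c hc
  have hX : IsPreconnected ((fun w : ℂ => w ^ 2) '' (s '' K))ᶜ := by
    rw [image_image]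
    refine isPreconnected_compl_of_hasLogOn (hK.image_of_continuousOn ((hs.mono hKV).pow 2))
      fun p hp => ?_
    exact HasLogOn.image (f := fun w => w - p) hK ((hs.mono hKV).pow 2) (hinj.mono hKV)
      (hf K hKV hK hKc p hp)
  have hSc := isPreconnected_compl_of_sq (hK.image_of_continuousOn (hs.mono hKV)) (by
    rintro _ ⟨x, hx, rfl⟩ ⟨y, hy, hxy⟩
    have : x = y := hinj (hKV hx) (hKV hy) (by simp [hxy])
    subst this
    exact h0 x (hKV hx) (by linear_combination (1 / 2 : ℂ) * hxy)) hX
  exact (hasLogOn_sub_of_isPreconnected_compl (hK.image_of_continuousOn (hs.mono hKV)) hSc hc).comp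
    (hs.mono hKV) (mapsTo_image s K)

lemma LogClass.of_approx {V : Set ℂ} {f : ℂ → ℂ} (hf : ContinuousOn f V)
    (h : ∀ K ⊆ V, IsCompact K → ∀ δ > 0, ∃ g, ContinuousOn g V ∧ LogClass V g ∧
      ∀ z ∈ K, ‖g z - f z‖ < δ) : LogClass V f := by
  intro K hKV hK hKc c hc
  obtain ⟨δ, hδ, hball⟩ := Metric.isOpen_iff.1
    (hK.image_of_continuousOn (hf.mono hKV)).isClosed.isOpen_compl c hc
  have hfar : ∀ z ∈ K, δ ≤ ‖f z - c‖ := fun z hz => by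
    by_contra! h
    exact hball (by rwa [mem_ball, dist_eq_norm]) ⟨z, hz, rfl⟩
  obtain ⟨g, hgc, hg, hgf⟩ := h K hKV hK δ hδ
  have hfc : ∀ z ∈ K, f z - c ≠ 0 := fun z hz h => by
    have := hfar z hz; rw [h, norm_zero] at this; linarith
  have hgn : c ∉ g '' K := by
    rintro ⟨z, hz, rfl⟩
    have := hfar z hz
    rw [norm_sub_rev] at this
    linarith [hgf z hz]
  have hr : HasLogOn (fun z => (g z - c) / (f z - c)) K := by
    refine hasLogOn_of_norm_sub_one_lt (((hgc.mono hKV).sub continuousOn_const).div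
      ((hf.mono hKV).sub continuousOn_const) hfc) fun z hz => ?_
    have : (g z - c) / (f z - c) - 1 = (g z - f z) / (f z - c) := by
      have := hfc z hz
      field_simp; ring
    rw [this, norm_div, div_lt_one (norm_pos_iff.2 (hfc z hz))]
    exact (hgf z hz).trans_le (hfar z hz)
  refine ((hg K hKV hK hKc c hgn).div hr).congr fun z hz => ?_
  have h1 := hfc z hz
  have h2 : g z - c ≠ 0 := fun h => hgn ⟨z, hz, sub_eq_zero.1 h⟩
  simp only
  field_simp

lemma exists_superset_isPreconnected_compl {V K : Set ℂ} (hV : IsPreconnected Vᶜ)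
    (hVb : ¬ Bornology.IsBounded Vᶜ) (hK : IsCompact K) (hKV : K ⊆ V) :
    ∃ K', K ⊆ K' ∧ K' ⊆ V ∧ IsCompact K' ∧ IsPreconnected K'ᶜ := by
  have hne : (Vᶜ).Nonempty := by
    rw [nonempty_iff_ne_empty]; rintro h; exact hVb (h ▸ Bornology.isBounded_empty)
  obtain ⟨r₀, hr₀⟩ := hne
  have hsub : Vᶜ ⊆ connectedComponentIn Kᶜ r₀ :=
    hV.subset_connectedComponentIn hr₀ (compl_subset_compl.2 hKV)
  obtain ⟨r, hr⟩ := hK.isBounded.subset_closedBall 0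
  have hbig := subset_connectedComponentIn_of_not_isBounded (p := r₀) rfl
    ((compl_compl K).le.trans hr) fun hb => hVb (hb.subset hsub)
  refine ⟨(connectedComponentIn Kᶜ r₀)ᶜ, ?_, compl_subset_comm.1 hsub, ?_, ?_⟩
  · exact subset_compl_comm.1 (connectedComponentIn_subset _ _)
  · exact Metric.isCompact_of_isClosed_isBounded
      hK.isClosed.isOpen_compl.connectedComponentIn.isClosed_compl
      (isBounded_closedBall.subset (compl_subset_comm.1 hbig))
  · rw [compl_compl]; exact isPreconnected_connectedComponentIn

lemma hasLogOn_of_forall_isCompact {V : Set ℂ} (hV : IsOpen V) (hVc : IsConnected V) {f : ℂ → ℂ}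
    (h : ∀ K ⊆ V, IsCompact K → HasLogOn f K) : HasLogOn f V := by
  obtain ⟨z₀, hz₀⟩ := hVc.nonempty
  obtain ⟨L₀, -, hL₀⟩ := h {z₀} (by simpa using hz₀) isCompact_singleton
  set l₀ := L₀ z₀
  have hl₀ : Complex.exp l₀ = f z₀ := hL₀ z₀ rfl
  have hnorm : ∀ K ⊆ V, IsCompact K → z₀ ∈ K →
      ∃ L : ℂ → ℂ, ContinuousOn L K ∧ (∀ z ∈ K, Complex.exp (L z) = f z) ∧ L z₀ = l₀ := by
    intro K hKV hK hzK
    obtain ⟨L, hL, hLf⟩ := h K hKV hK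
    refine ⟨fun z => L z + (l₀ - L z₀), hL.add continuousOn_const, fun z hz => ?_, by ring⟩
    rw [Complex.exp_add, Complex.exp_sub, hl₀, hLf z hz, hLf z₀ hzK,
      ← hl₀, div_self (Complex.exp_ne_zero _), mul_one]
  have huniq : ∀ K, IsPreconnected K → z₀ ∈ K → ∀ L M : ℂ → ℂ, ContinuousOn L K →
      ContinuousOn M K → (∀ z ∈ K, Complex.exp (L z) = f z) → (∀ z ∈ K, Complex.exp (M z) = f z) →
      L z₀ = l₀ → M z₀ = l₀ → EqOn L M K := by
    intro K hK hzK L M hL hM hLf hMf hL0 hM0 z hz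
    obtain ⟨c, -, hc⟩ := exists_const_of_exp_eq hK hL hM fun z hz => by rw [hLf z hz, hMf z hz]
    have := hc z₀ hzK
    rw [hL0, hM0] at this
    have hc0 : c = 0 := by simpa using this.symm
    simpa [hc0] using hc z hz
  have hpath : ∀ z ∈ V, ∃ K ⊆ V, IsCompact K ∧ IsPreconnected K ∧ z₀ ∈ K ∧ z ∈ K := by
    intro z hz
    have hP := hV.isConnected_iff_isPathConnected.1 hVc
    obtain ⟨γ, hγ⟩ := hP.joinedIn z₀ hz₀ z hz
    exact ⟨range γ, range_subset_iff.2 hγ, isCompact_range γ.continuous,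
      isPreconnected_range γ.continuous, ⟨0, γ.source⟩, ⟨1, γ.target⟩⟩
  choose! K hKV hK hKc hzK hKz using hpath
  choose! L hL using fun z hz => hnorm (K z) (hKV z hz) (hK z hz) (hzK z hz)
  have hkey : ∀ K' ⊆ V, IsCompact K' → IsPreconnected K' → z₀ ∈ K' → ∀ M : ℂ → ℂ,
      ContinuousOn M K' → (∀ z ∈ K', Complex.exp (M z) = f z) → M z₀ = l₀ →
      EqOn (fun z => L z z) M K' := by
    intro K' hKV' hK' hKc' hzK' M hM hMf hM0 z hz
    have hzV := hKV' hz
    obtain ⟨N, hN, hNf, hN0⟩ := hnorm (K' ∪ K z) (union_subset hKV' (hKV z hzV))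
      (hK'.union (hK z hzV)) (.inl hzK')
    have e1 := huniq K' hKc' hzK' N M (hN.mono subset_union_left) hM
      (fun z hz => hNf z (.inl hz)) hMf hN0 hM0 hz
    have e2 := huniq (K z) (hKc z hzV) (hzK z hzV) N (L z) (hN.mono subset_union_right)
      (hL z hzV).1 (fun w hw => hNf w (.inr hw)) (hL z hzV).2.1 hN0 (hL z hzV).2.2 (hKz z hzV)
    exact e2.symm.trans e1
  refine ⟨fun z => L z z, fun z hz => ContinuousAt.continuousWithinAt ?_,
    fun z hz => (hL z hz).2.1 z (hKz z hz)⟩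
  obtain ⟨ε, hε, hball⟩ := Metric.nhds_basis_closedBall.mem_iff.1 (hV.mem_nhds hz)
  have hsub : K z ∪ closedBall z ε ⊆ V := union_subset (hKV z hz) hball
  have hcomp := (hK z hz).union (isCompact_closedBall z ε)
  have hconn : IsPreconnected (K z ∪ closedBall z ε) :=
    (hKc z hz).union z (hKz z hz) (mem_closedBall_self hε.le)
      (convex_closedBall z ε).isPreconnected
  obtain ⟨M, hM, hMf, hM0⟩ := hnorm _ hsub hcomp (.inl (hzK z hz))
  have hev : (fun z => L z z) =ᶠ[𝓝 z] M :=
    mem_of_superset (closedBall_mem_nhds z hε) fun w hw =>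
      hkey _ hsub hcomp hconn (.inl (hzK z hz)) M hM hMf hM0 (.inr hw)
  exact ((hM.mono subset_union_right).continuousAt (closedBall_mem_nhds z hε)).congr hev.symm

/-- An injective holomorphic nonvanishing function in the class has a square root in the class. -/
lemma LogClass.exists_sqrt {V : Set ℂ} (hV : IsOpen V) (hVc : IsConnected V)
    (hR : IsPreconnected Vᶜ) (hRb : ¬ Bornology.IsBounded Vᶜ) {f : ℂ → ℂ}
    (hf : DifferentiableOn ℂ f V) (hinj : InjOn f V) (hL : LogClass V f) (h0 : ∀ z ∈ V, f z ≠ 0) :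
    ∃ s : ℂ → ℂ, DifferentiableOn ℂ s V ∧ (∀ z ∈ V, s z ^ 2 = f z) ∧ LogClass V s := by
  obtain ⟨L, hLc, hLf⟩ : HasLogOn f V := by
    refine hasLogOn_of_forall_isCompact hV hVc fun K hKV hK => ?_
    obtain ⟨K', h1, h2, h3, h4⟩ := exists_superset_isPreconnected_compl hR hRb hK hKV
    have := hL K' h2 h3 h4 0 (by rintro ⟨z, hz, h⟩; exact h0 z (h2 hz) h)
    simpa using this.mono h1
  set s : ℂ → ℂ := fun z => Complex.exp (L z / 2)
  have hsc : ContinuousOn s V := Complex.continuous_exp.comp_continuousOn (hLc.div_const _)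
  have hs0 : ∀ z, s z ≠ 0 := fun z => Complex.exp_ne_zero _
  have hsf : ∀ z ∈ V, s z ^ 2 = f z := fun z hz => by
    rw [← hLf z hz, ← Complex.exp_nat_mul]; congr 1; push_cast; ring
  refine ⟨s, fun w hw => DifferentiableAt.differentiableWithinAt ?_, hsf, ?_⟩
  · have hcs : ContinuousAt s w := hsc.continuousAt (hV.mem_nhds hw)
    have hfd := ((hf.differentiableAt (hV.mem_nhds hw)).hasDerivAt)
    have h2 : s w + s w ≠ 0 := by rw [← two_mul]; exact mul_ne_zero two_ne_zero (hs0 w)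
    refine HasDerivAt.differentiableAt (f' := deriv f w / (s w + s w))
      (hasDerivAt_iff_tendsto_slope.2 ?_)
    have hlim := (hasDerivAt_iff_tendsto_slope.1 hfd).div
      ((hcs.tendsto.add_const (s w)).mono_left nhdsWithin_le_nhds) h2
    refine hlim.congr' ?_
    have hne : ∀ᶠ z in 𝓝[≠] w, s z + s w ≠ 0 :=
      ((hcs.tendsto.add_const (s w)).mono_left nhdsWithin_le_nhds).eventually_ne h2
    filter_upwards [hne, mem_nhdsWithin_of_mem_nhds (hV.mem_nhds hw)] with z hz hzV
    simp only [Pi.div_apply, slope_def_field]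
    rw [← hsf z hzV, ← hsf w hw, div_div, sq_sub_sq, mul_comm (z - w), mul_div_mul_left _ _ hz]
  · refine LogClass.sqrt hsc (hinj.congr fun z hz => (hsf z hz).symm) (fun z _ => hs0 z) ?_
    intro K hKV hK hKc c hc
    refine (hL K hKV hK hKc c ?_).congr fun z hz => by simp only [hsf z (hKV hz)]
    rintro ⟨z, hz, rfl⟩
    exact hc ⟨z, hz, hsf z (hKV hz)⟩

end PlaneArc

namespace PlaneArc

open Filter Topology

open ComplexConjugate in
/-- The disc automorphism sending `a` to `0`. -/
noncomputable def mob (a w : ℂ) : ℂ := (w - a) / (1 - conj a * w)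

open ComplexConjugate in
lemma one_sub_conj_mul_ne_zero {a w : ℂ} (ha : ‖a‖ < 1) (hw : ‖w‖ < 1) : 1 - conj a * w ≠ 0 := by
  intro h
  have h1 : ‖conj a * w‖ = 1 := by rw [← sub_eq_zero.1 h, norm_one]
  rw [norm_mul, RCLike.norm_conj] at h1
  nlinarith [norm_nonneg a, norm_nonneg w]

open ComplexConjugate in
lemma norm_mob_lt {a w : ℂ} (ha : ‖a‖ < 1) (hw : ‖w‖ < 1) : ‖mob a w‖ < 1 := by
  have h0 := one_sub_conj_mul_ne_zero ha hw
  rw [mob, norm_div, div_lt_one (norm_pos_iff.2 h0)]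
  refine lt_of_pow_lt_pow_left₀ 2 (norm_nonneg _) ?_
  have e : ‖1 - conj a * w‖ ^ 2 - ‖w - a‖ ^ 2 = (1 - ‖a‖ ^ 2) * (1 - ‖w‖ ^ 2) := by
    simp only [Complex.sq_norm, Complex.normSq_apply, Complex.sub_re, Complex.sub_im,
      Complex.mul_re, Complex.mul_im, Complex.conj_re, Complex.conj_im, Complex.one_re,
      Complex.one_im]
    ring
  have : 0 < (1 - ‖a‖ ^ 2) * (1 - ‖w‖ ^ 2) :=
    mul_pos (by nlinarith [norm_nonneg a]) (by nlinarith [norm_nonneg w])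
  linarith

lemma mob_eq_zero {a w : ℂ} (ha : ‖a‖ < 1) (hw : ‖w‖ < 1) : mob a w = 0 ↔ w = a := by
  rw [mob, div_eq_zero_iff, or_iff_left (one_sub_conj_mul_ne_zero ha hw), sub_eq_zero]

open ComplexConjugate in
lemma injOn_mob {a : ℂ} (ha : ‖a‖ < 1) : InjOn (mob a) (ball 0 1) := by
  intro w hw w' hw' h
  rw [mem_ball_zero_iff] at hw hw'
  rw [mob, mob, div_eq_div_iff (one_sub_conj_mul_ne_zero ha hw)
    (one_sub_conj_mul_ne_zero ha hw')] at h
  have h1 := one_sub_conj_mul_ne_zero ha ha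
  have : (1 - conj a * a) * (w - w') = 0 := by linear_combination h
  exact sub_eq_zero.1 ((mul_eq_zero.1 this).resolve_left h1)

/-- Injective holomorphic maps to the disc in the class. -/
structure IsDiscMap (V : Set ℂ) (f : ℂ → ℂ) : Prop where
  diff : DifferentiableOn ℂ f V
  maps : MapsTo f V (ball 0 1)
  inj : InjOn f V
  log : LogClass V f

lemma IsDiscMap.norm_lt {V : Set ℂ} {f : ℂ → ℂ} (hf : IsDiscMap V f) {z : ℂ} (hz : z ∈ V) :
    ‖f z‖ < 1 := by simpa using hf.maps hz

open ComplexConjugate in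
lemma IsDiscMap.mob {V : Set ℂ} {f : ℂ → ℂ} (hf : IsDiscMap V f) {a : ℂ} (ha : ‖a‖ < 1) :
    IsDiscMap V fun z => mob a (f z) := by
  have h0 : ∀ z ∈ V, 1 - conj a * f z ≠ 0 := fun z hz =>
    one_sub_conj_mul_ne_zero ha (hf.norm_lt hz)
  refine ⟨(hf.diff.sub_const a).div ((hf.diff.const_mul (conj a)).const_sub 1) h0,
    fun z hz => by simpa using norm_mob_lt ha (hf.norm_lt hz), ?_, ?_⟩
  · exact fun z hz w hw h => hf.inj hz hw (injOn_mob ha (hf.maps hz) (hf.maps hw) h)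
  · have := hf.log.moebius (a := 1) (b := -a) (c := -conj a) (d := 1) fun z hz => by
      have := h0 z hz
      rwa [neg_mul, neg_add_eq_sub]
    convert this using 2 with z
    rw [PlaneArc.mob]
    ring_nf

lemma exists_mem_ne_of_mem_nhds {U : Set ℂ} {z : ℂ} (hU : U ∈ 𝓝 z) : ∃ w ∈ U, w ≠ z := by
  obtain ⟨w, h1, h2⟩ := (Filter.Eventually.and (mem_nhdsWithin_of_mem_nhds hU)
    (self_mem_nhdsWithin (s := {z}ᶜ))).exists
  exact ⟨w, h1, h2⟩

lemma isOpen_image_of_injOn {V : Set ℂ} (hV : IsOpen V) {f : ℂ → ℂ}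
    (hf : DifferentiableOn ℂ f V) (hinj : InjOn f V) {U : Set ℂ} (hU : IsOpen U) (hUV : U ⊆ V) :
    IsOpen (f '' U) := by
  rw [isOpen_iff_mem_nhds]
  rintro _ ⟨z, hz, rfl⟩
  have han : AnalyticAt ℂ f z := hf.analyticAt (hV.mem_nhds (hUV hz))
  rcases han.eventually_constant_or_nhds_le_map_nhds with h | h
  · obtain ⟨w, ⟨hw, hwU⟩, hwz⟩ := exists_mem_ne_of_mem_nhds (inter_mem h (hU.mem_nhds hz))
    exact absurd (hinj (hUV hwU) (hUV hz) hw) hwz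
  · exact h (image_mem_map (hU.mem_nhds hz))

lemma tendstoLocallyUniformlyOn_of_pointwise {V : Set ℂ} (hV : IsOpen V) {ι : Type*}
    {l : Filter ι} [l.NeBot] {F : ι → ℂ → ℂ} {g : ℂ → ℂ} (hF : ∀ n, DifferentiableOn ℂ (F n) V)
    (hFb : ∀ n, MapsTo (F n) V (ball 0 1)) (hlim : ∀ z ∈ V, Tendsto (fun n => F n z) l (𝓝 (g z))) :
    TendstoLocallyUniformlyOn F g l V := by
  rw [Metric.tendstoLocallyUniformlyOn_iff]
  intro ε hε z hz
  obtain ⟨R, hR, hball⟩ := Metric.isOpen_iff.1 hV z hz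
  have hLip : ∀ n, ∀ y ∈ ball z R, dist (F n y) (F n z) ≤ 2 / R * dist y z := by
    intro n y hy
    refine Complex.dist_le_div_mul_dist_of_mapsTo_ball ((hF n).mono hball) ?_ hy
    intro w hw
    have h1 := hFb n (hball hw)
    have h2 := hFb n hz
    rw [mem_ball_zero_iff] at h1 h2
    rw [mem_closedBall, dist_eq_norm]
    linarith [norm_sub_le (F n w) (F n z)]
  set δ := min R (ε * R / 8) with hδ
  have hδ0 : 0 < δ := by positivity
  refine ⟨ball z δ, mem_nhdsWithin_of_mem_nhds (ball_mem_nhds z hδ0), ?_⟩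
  have hsmall : ∀ n, ∀ y ∈ ball z δ, dist (F n y) (F n z) ≤ ε / 4 := by
    intro n y hy
    have hy' : dist y z < δ := hy
    refine (hLip n y (ball_subset_ball (min_le_left _ _) hy)).trans ?_
    have : dist y z ≤ ε * R / 8 := hy'.le.trans (min_le_right _ _)
    calc 2 / R * dist y z ≤ 2 / R * (ε * R / 8) := by gcongr
      _ = ε / 4 := by field_simp; norm_num
  have hg : ∀ y ∈ ball z δ, dist (g y) (g z) ≤ ε / 4 := fun y hy =>
    le_of_tendsto ((hlim y (hball (ball_subset_ball (min_le_left _ _) hy))).dist (hlim z hz))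
      (Eventually.of_forall fun n => hsmall n y hy)
  filter_upwards [Metric.tendsto_nhds.1 (hlim z hz) (ε / 4) (by positivity)] with n hn y hy
  have h1 := hsmall n y hy
  have h2 := hg y hy
  have h3 := dist_triangle4 (g y) (g z) (F n z) (F n y)
  rw [dist_comm (g z), dist_comm (F n z) (F n y)] at h3
  linarith

/-- Hurwitz's theorem for injective maps. -/
lemma injOn_of_tendstoLocallyUniformlyOn {V : Set ℂ} (hV : IsOpen V) (hVc : IsPreconnected V)
    {ι : Type*} {l : Filter ι} [l.NeBot] {F : ι → ℂ → ℂ} {g : ℂ → ℂ}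
    (hF : ∀ n, DifferentiableOn ℂ (F n) V) (hinj : ∀ n, InjOn (F n) V)
    (hlim : TendstoLocallyUniformlyOn F g l V) (hg : DifferentiableOn ℂ g V)
    (hne : ∃ z ∈ V, ∃ w ∈ V, g z ≠ g w) : InjOn g V := by
  intro a ha b hb hab
  by_contra hab'
  have hiso : ∀ᶠ z in 𝓝[≠] b, g z ≠ g b := by
    rcases (hg.analyticAt (hV.mem_nhds hb)).eventually_eq_or_eventually_ne
      (analyticAt_const (v := g b)) with h | h
    · obtain ⟨z, hz, w, hw, hzw⟩ := hne
      have := (hg.analyticOnNhd hV).eqOn_of_preconnected_of_eventuallyEq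
        analyticOnNhd_const hVc hb h
      exact absurd ((this hz).trans (this hw).symm) hzw
    · exact h
  obtain ⟨r, hr, hrsub⟩ : ∃ r > 0, closedBall b r ⊆ {z | z ∈ V ∧ (z ≠ b → g z ≠ g b) ∧ z ≠ a} := by
    refine Metric.nhds_basis_closedBall.mem_iff.1 ?_
    filter_upwards [hV.mem_nhds hb, eventually_nhdsWithin_iff.1 hiso,
      isOpen_ne.mem_nhds (Ne.symm hab')] with z h1 h2 h3
    exact ⟨h1, h2, h3⟩
  have hsV : sphere b r ⊆ V := fun z hz => (hrsub (sphere_subset_closedBall hz)).1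
  obtain ⟨x, hx, hmin⟩ := (isCompact_sphere b r).exists_isMinOn
    (NormedSpace.sphere_nonempty.2 hr.le)
    (f := fun z => ‖g z - g b‖) ((hg.continuousOn.mono hsV).sub continuousOn_const).norm
  set ε := ‖g x - g b‖ with hε
  have hε0 : 0 < ε := by
    rw [hε, norm_pos_iff, sub_ne_zero]
    refine (hrsub (sphere_subset_closedBall hx)).2.1 ?_
    rintro rfl
    rw [mem_sphere, dist_self] at hx
    exact hr.ne hx
  have hKV : insert a (closedBall b r) ⊆ V := insert_subset ha fun z hz => (hrsub hz).1
  obtain ⟨n, hn⟩ := (Metric.tendstoUniformlyOn_iff.1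
    ((tendstoLocallyUniformlyOn_iff_forall_isCompact hV).1 hlim _ hKV
      ((isCompact_closedBall b r).insert a)) (ε / 8) (by positivity)).exists
  have hnb := hn b (mem_insert_of_mem _ (mem_closedBall_self hr.le))
  have hna := hn a (mem_insert _ _)
  have hbV : closedBall b r ⊆ V := fun z hz => (hrsub hz).1
  have hsph : ∀ z ∈ sphere b r, ε / 2 ≤ ‖F n z - F n b‖ := by
    intro z hz
    have h1 := hn z (mem_insert_of_mem _ (sphere_subset_closedBall hz))
    have h2 : ε ≤ dist (g z) (g b) := by rw [dist_eq_norm]; exact hmin hz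
    have h3 := dist_triangle4 (g z) (F n z) (F n b) (g b)
    rw [dist_comm (F n b) (g b), dist_eq_norm (F n z)] at h3
    linarith
  have hfreq : ∃ᶠ z in 𝓝 b, F n z ≠ F n b := by
    have : ∀ᶠ z in 𝓝[≠] b, F n z ≠ F n b := by
      filter_upwards [mem_nhdsWithin_of_mem_nhds (hV.mem_nhds hb), self_mem_nhdsWithin]
        with z hz hzb h
      exact hzb (hinj n hz hb h)
    exact this.frequently.filter_mono nhdsWithin_le_nhds
  have hball := DiffContOnCl.ball_subset_image_closedBall (f := F n) (z₀ := b)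
    (((hF n).mono (hbV.trans' closure_ball_subset_closedBall)).diffContOnCl) hr hsph hfreq
  have hmem : F n a ∈ ball (F n b) (ε / 2 / 2) := by
    rw [mem_ball]
    have h3 := dist_triangle4 (F n a) (g a) (g b) (F n b)
    rw [hab] at hna h3
    rw [dist_self, dist_comm (F n a) (g b)] at h3
    linarith
  obtain ⟨c, hc, hca⟩ := hball hmem
  exact (hrsub hc).2.2 (hinj n (hbV hc) ha hca)

lemma exists_isDiscMap {V : Set ℂ} (hV : IsOpen V) (hVc : IsConnected V)
    (hR : IsPreconnected Vᶜ) (hRb : ¬ Bornology.IsBounded Vᶜ) {z₀ : ℂ} (hz₀ : z₀ ∈ V) :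
    ∃ f, IsDiscMap V f ∧ f z₀ = 0 := by
  obtain ⟨a, ha⟩ : (Vᶜ).Nonempty := by
    rw [nonempty_iff_ne_empty]; rintro h; exact hRb (h ▸ Bornology.isBounded_empty)
  have hlog : LogClass V fun z => z - a := by
    have := (logClass_id V).moebius (a := 1) (b := -a) (c := 0) (d := 1) (by simp)
    simpa [sub_eq_add_neg] using this
  obtain ⟨s, hs, hsf, hslog⟩ := hlog.exists_sqrt hV hVc hR hRb (by fun_prop)
    (fun z _ w _ h => sub_left_injective h) fun z hz h => ha (sub_eq_zero.1 h ▸ hz)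
  have hsinj : InjOn s V := fun z hz w hw h => by
    have := (hsf z hz).symm.trans ((congrArg (· ^ 2) h).trans (hsf w hw))
    exact sub_left_injective this
  obtain ⟨ε, hε, hball⟩ := Metric.isOpen_iff.1 (isOpen_image_of_injOn hV hs hsinj hV subset_rfl)
    (s z₀) ⟨z₀, hz₀, rfl⟩
  have hfar : ∀ z ∈ V, ε ≤ ‖s z + s z₀‖ := by
    intro z hz
    by_contra! h
    have : -s z ∈ ball (s z₀) ε := by
      rwa [mem_ball, dist_eq_norm, show -s z - s z₀ = -(s z + s z₀) by ring, norm_neg]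
    obtain ⟨w, hw, hwz⟩ := hball this
    have hwz' : w = z := by
      have : s w ^ 2 = s z ^ 2 := by rw [hwz]; ring
      rw [hsf w hw, hsf z hz] at this
      exact sub_left_injective this
    subst hwz'
    have h0 : s w = 0 := by linear_combination (1 / 2 : ℂ) * hwz
    have := hsf w hw
    rw [h0, zero_pow two_ne_zero] at this
    exact ha (sub_eq_zero.1 this.symm ▸ hw)
  have h0 : ∀ z ∈ V, s z + s z₀ ≠ 0 := fun z hz h => by
    have := hfar z hz
    rw [h, norm_zero] at this
    linarith
  have hf : IsDiscMap V fun z => (ε / 2 : ℂ) / (s z + s z₀) := by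
    refine ⟨(differentiableOn_const _).div (hs.add_const _) h0, fun z hz => ?_, ?_, ?_⟩
    · have hpos : 0 < ‖s z + s z₀‖ := norm_pos_iff.2 (h0 z hz)
      rw [mem_ball_zero_iff, norm_div, div_lt_one hpos]
      have : ‖(ε / 2 : ℂ)‖ = ε / 2 := by
        rw [norm_div, Complex.norm_real, Real.norm_of_nonneg hε.le]; simp
      linarith [hfar z hz]
    · intro z hz w hw h
      have h2 : (ε / 2 : ℂ) ≠ 0 := by
        simpa using hε.ne'
      simp only at h
      rw [div_eq_div_iff (h0 z hz) (h0 w hw)] at h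
      exact hsinj hz hw (by linear_combination -(mul_left_cancel₀ h2 h))
    · have := hslog.moebius (a := 0) (b := ε / 2) (c := 1) (d := s z₀) fun z hz => by
        simpa using h0 z hz
      simpa using this
  refine ⟨_, hf.mob (hf.norm_lt hz₀), ?_⟩
  exact (mob_eq_zero (hf.norm_lt hz₀) (hf.norm_lt hz₀)).2 rfl

open ComplexConjugate in
/-- Koebe's square root trick. -/
lemma IsDiscMap.exists_norm_lt {V : Set ℂ} (hV : IsOpen V) (hVc : IsConnected V)
    (hR : IsPreconnected Vᶜ) (hRb : ¬ Bornology.IsBounded Vᶜ) {z₀ z₁ : ℂ} (hz₀ : z₀ ∈ V)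
    (hz₁ : z₁ ∈ V) {f : ℂ → ℂ} (hf : IsDiscMap V f) (hf0 : f z₀ = 0) (hf1 : f z₁ ≠ 0) {a : ℂ}
    (ha : ‖a‖ < 1) (haf : a ∉ f '' V) :
    ∃ g, IsDiscMap V g ∧ g z₀ = 0 ∧ ‖f z₁‖ < ‖g z₁‖ := by
  have hfa := hf.mob ha
  obtain ⟨s, hs, hsf, hslog⟩ := hfa.log.exists_sqrt hV hVc hR hRb hfa.diff hfa.inj
    fun z hz h => haf ⟨z, hz, (mob_eq_zero ha (hf.norm_lt hz)).1 h⟩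
  have hsD : IsDiscMap V s := by
    refine ⟨hs, fun z hz => ?_, fun z hz w hw h => ?_, hslog⟩
    · have : ‖s z‖ ^ 2 < 1 := by
        rw [← norm_pow, hsf z hz]; exact hfa.norm_lt hz
      rw [mem_ball_zero_iff]
      nlinarith [norm_nonneg (s z)]
    · exact hfa.inj hz hw (by rw [← hsf z hz, ← hsf w hw, h])
  have hb := hsD.norm_lt hz₀
  have hs1 := hsD.norm_lt hz₁
  have hb' : ‖-s z₀‖ < 1 := by rwa [norm_neg]
  refine ⟨_, hsD.mob hb, (mob_eq_zero hb hb).2 rfl, ?_⟩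
  have key : f z₁ = PlaneArc.mob (s z₀) (s z₁) * PlaneArc.mob (-s z₀) (s z₁) := by
    have e0 : a = -s z₀ ^ 2 := by
      have := hsf z₀ hz₀
      rw [hf0, PlaneArc.mob] at this
      simp at this
      rw [this, neg_neg]
    have e1 := hsf z₁ hz₁
    rw [PlaneArc.mob, eq_div_iff (one_sub_conj_mul_ne_zero ha (hf.norm_lt hz₁)), e0] at e1
    simp only [map_neg, map_pow] at e1
    rw [PlaneArc.mob, PlaneArc.mob, div_mul_div_comm, eq_div_iff (mul_ne_zero
      (one_sub_conj_mul_ne_zero hb hs1) (one_sub_conj_mul_ne_zero hb' hs1))]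
    simp only [map_neg]
    linear_combination -e1
  have hne : PlaneArc.mob (s z₀) (s z₁) ≠ 0 := fun h => hf1 (by rw [key, h, zero_mul])
  rw [key, norm_mul]
  exact mul_lt_of_lt_one_right (norm_pos_iff.2 hne) (norm_mob_lt hb' hs1)

/-- Riemann mapping theorem for a domain whose complement is connected and unbounded. -/
lemma exists_isDiscMap_image_eq {V : Set ℂ} (hV : IsOpen V) (hVc : IsConnected V)
    (hR : IsPreconnected Vᶜ) (hRb : ¬ Bornology.IsBounded Vᶜ) {z₀ : ℂ} (hz₀ : z₀ ∈ V) :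
    ∃ f, IsDiscMap V f ∧ f z₀ = 0 ∧ f '' V = ball 0 1 := by
  obtain ⟨f₀, hf₀, hf₀0⟩ := exists_isDiscMap hV hVc hR hRb hz₀
  obtain ⟨z₁, hz₁, hz₁0⟩ : ∃ z ∈ V, z ≠ z₀ :=
    exists_mem_ne_of_mem_nhds (hV.mem_nhds hz₀)
  set S : Set ℝ := (fun f : ℂ → ℂ => ‖f z₁‖) '' {f | IsDiscMap V f ∧ f z₀ = 0} with hS
  have hSb : BddAbove S := ⟨1, by rintro _ ⟨f, ⟨hf, -⟩, rfl⟩; exact (hf.norm_lt hz₁).le⟩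
  have hS0 : ‖f₀ z₁‖ ∈ S := ⟨f₀, ⟨hf₀, hf₀0⟩, rfl⟩
  obtain ⟨u, -, hu, huS⟩ := exists_seq_tendsto_sSup ⟨_, hS0⟩ hSb
  choose F hF hFu using huS
  have hlim : ∀ z, ∃ w, z ∈ V → w ∈ closedBall (0 : ℂ) 1 ∧
      Tendsto (fun n => F n z) (hyperfilter ℕ : Filter ℕ) (𝓝 w) := by
    intro z
    by_cases hz : z ∈ V
    · obtain ⟨w, hw, hle⟩ := (isCompact_closedBall (0 : ℂ) 1).ultrafilter_le_nhds
        ((hyperfilter ℕ).map fun n => F n z) (by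
          rw [le_principal_iff]
          change (fun n => F n z) ⁻¹' closedBall 0 1 ∈ (hyperfilter ℕ : Filter ℕ)
          exact univ_mem' fun n => ball_subset_closedBall ((hF n).1.maps hz))
      exact ⟨w, fun _ => ⟨hw, hle⟩⟩
    · exact ⟨0, fun h => absurd h hz⟩
  choose g hg using hlim
  have hloc : TendstoLocallyUniformlyOn F g (hyperfilter ℕ : Filter ℕ) V :=
    tendstoLocallyUniformlyOn_of_pointwise hV (fun n => (hF n).1.diff) (fun n => (hF n).1.maps)
      fun z hz => (hg z hz).2
  have hgd : DifferentiableOn ℂ g V :=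
    hloc.differentiableOn (Eventually.of_forall fun n => (hF n).1.diff) hV
  have hg0 : g z₀ = 0 :=
    tendsto_nhds_unique (hg z₀ hz₀).2 (by simp only [(hF _).2]; exact tendsto_const_nhds)
  have hg1 : ‖g z₁‖ = sSup S := by
    refine tendsto_nhds_unique (hg z₁ hz₁).2.norm ?_
    have : (fun n => ‖F n z₁‖) = u := funext hFu
    rw [this]
    exact hu.mono_left (by rw [← Nat.cofinite_eq_atTop]; exact hyperfilter_le_cofinite)
  have hg1' : g z₁ ≠ 0 := by
    have h1 : f₀ z₁ ≠ 0 := fun h => hz₁0 (hf₀.inj hz₁ hz₀ (h.trans hf₀0.symm))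
    have h2 := le_csSup hSb hS0
    rw [← hg1] at h2
    exact norm_pos_iff.1 ((norm_pos_iff.2 h1).trans_le h2)
  have hginj : InjOn g V := injOn_of_tendstoLocallyUniformlyOn hV hVc.isPreconnected
    (fun n => (hF n).1.diff) (fun n => (hF n).1.inj) hloc hgd
    ⟨z₁, hz₁, z₀, hz₀, by rwa [hg0]⟩
  have hgD : IsDiscMap V g := by
    refine ⟨hgd, ?_, hginj, ?_⟩
    · have h1 : g '' V ⊆ closedBall 0 1 := image_subset_iff.2 fun z hz => (hg z hz).1
      have h2 := interior_maximal h1 (isOpen_image_of_injOn hV hgd hginj hV subset_rfl)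
      rw [interior_closedBall _ one_ne_zero] at h2
      exact mapsTo_iff_image_subset.2 h2
    · refine LogClass.of_approx hgd.continuousOn fun K hKV hK δ hδ => ?_
      obtain ⟨n, hn⟩ := (Metric.tendstoUniformlyOn_iff.1
        ((tendstoLocallyUniformlyOn_iff_forall_isCompact hV).1 hloc _ hKV hK) δ hδ).exists
      refine ⟨F n, (hF n).1.diff.continuousOn, (hF n).1.log, fun z hz => ?_⟩
      rw [← dist_eq_norm, dist_comm]
      exact hn z hz
  refine ⟨g, hgD, hg0, subset_antisymm (mapsTo_iff_image_subset.1 hgD.maps) fun a ha => ?_⟩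
  by_contra haf
  obtain ⟨f, hf, hf0, hlt⟩ := hgD.exists_norm_lt hV hVc hR hRb hz₀ hz₁ hg0 hg1'
    (by simpa using ha) haf
  rw [hg1] at hlt
  exact absurd (le_csSup hSb ⟨f, ⟨hf, hf0⟩, rfl⟩) (not_le.2 hlt)

lemma exists_inverse {V : Set ℂ} (hV : IsOpen V) {f : ℂ → ℂ} (hf : DifferentiableOn ℂ f V)
    (hinj : InjOn f V) {W : Set ℂ} (hW : f '' V = W) :
    ∃ g : ℂ → ℂ, DifferentiableOn ℂ g W ∧ InjOn g W ∧ g '' W = V ∧ ∀ z ∈ V, g (f z) = z := by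
  set g := Function.invFunOn f V
  have hgf : ∀ z ∈ V, g (f z) = z := fun z hz => hinj.leftInvOn_invFunOn hz
  have hfg : ∀ w ∈ W, f (g w) = w := by
    rw [← hW]; rintro _ ⟨z, hz, rfl⟩; rw [hgf z hz]
  have hgV : ∀ w ∈ W, g w ∈ V := by
    rw [← hW]; rintro _ ⟨z, hz, rfl⟩; rwa [hgf z hz]
  have hWo : IsOpen W := hW ▸ isOpen_image_of_injOn hV hf hinj hV subset_rfl
  have hgc : ∀ w ∈ W, ContinuousAt g w := by
    intro w hw U hU
    obtain ⟨U', hU'U, hU'o, hU'w⟩ := _root_.mem_nhds_iff.1 (inter_mem hU (hV.mem_nhds (hgV w hw)))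
    refine mem_map.2 <| mem_of_superset ((isOpen_image_of_injOn hV hf hinj hU'o
      (hU'U.trans inter_subset_right)).mem_nhds ⟨g w, hU'w, hfg w hw⟩) ?_
    rintro _ ⟨z, hz, rfl⟩
    rw [mem_preimage, hgf z (hU'U hz).2]
    exact (hU'U hz).1
  refine ⟨g, fun w hw => DifferentiableAt.differentiableWithinAt ?_, ?_, ?_, hgf⟩
  · refine (Complex.analyticAt_of_differentiable_on_punctured_nhds_of_continuousAt ?_
      (hgc w hw)).differentiableAt
    have hda : AnalyticAt ℂ (deriv f) (g w) := (hf.analyticAt (hV.mem_nhds (hgV w hw))).deriv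
    have hd : ∀ᶠ z in 𝓝[≠] (g w), deriv f z ≠ 0 := by
      rcases hda.eventually_eq_zero_or_eventually_ne_zero with h | h
      · exfalso
        obtain ⟨r, hr, hball⟩ := Metric.mem_nhds_iff.1 (inter_mem h (hV.mem_nhds (hgV w hw)))
        obtain ⟨z, h1, h2⟩ := exists_mem_ne_of_mem_nhds (ball_mem_nhds (g w) hr)
        refine h2 (hinj (hball h1).2 (hgV w hw) ?_)
        exact isOpen_ball.is_const_of_deriv_eq_zero (convex_ball _ _).isPreconnected
          (hf.mono fun z hz => (hball hz).2) (fun z hz => (hball hz).1) h1 (mem_ball_self hr)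
      · exact h
    have hg' : Tendsto g (𝓝[≠] w) (𝓝[≠] (g w)) := by
      refine tendsto_nhdsWithin_iff.2 ⟨(hgc w hw).tendsto.mono_left nhdsWithin_le_nhds, ?_⟩
      filter_upwards [mem_nhdsWithin_of_mem_nhds (hWo.mem_nhds hw), self_mem_nhdsWithin]
        with x hx hxw h
      exact hxw ((hfg x hx).symm.trans ((congrArg f h).trans (hfg w hw)))
    filter_upwards [hg'.eventually hd, mem_nhdsWithin_of_mem_nhds (hWo.mem_nhds hw)] with x hx hxW
    refine (HasDerivAt.of_local_left_inverse (hgc x hxW)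
      (hf.differentiableAt (hV.mem_nhds (hgV x hxW))).hasDerivAt hx ?_).differentiableAt
    filter_upwards [hWo.mem_nhds hxW] with y hy using hfg y hy
  · intro x hx y hy h
    rw [← hfg x hx, h, hfg y hy]
  · refine subset_antisymm (image_subset_iff.2 hgV) fun z hz => ⟨f z, hW ▸ ⟨z, hz, rfl⟩, hgf z hz⟩

end PlaneArc

namespace PlaneArc

open Filter Topology MeasureTheory

/-- `α` restricts to an embedding of the unit interval. -/
structure IsArcMap (α : ℝ → ℂ) : Prop where
  cont : Continuous α
  inj : InjOn α (Icc 0 1)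

lemma IsArcMap.isCompact {α : ℝ → ℂ} (h : IsArcMap α) : IsCompact (α '' Icc 0 1) :=
  isCompact_Icc.image h.cont

lemma IsArcMap.isPreconnected_compl_image {α : ℝ → ℂ} (h : IsArcMap α) {a b : ℝ} (ha : 0 ≤ a)
    (hab : a ≤ b) (hb : b ≤ 1) : IsPreconnected (α '' Icc a b)ᶜ := by
  refine isPreconnected_compl_of_hasLogOn (isCompact_Icc.image h.cont) fun p hp => ?_
  have hc : Continuous fun z : ℂ => (projIcc a b hab z.re : ℝ) :=
    continuous_subtype_val.comp (continuous_projIcc.comp Complex.continuous_re)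
  have h1 : HasLogOn (fun z : ℂ => α (projIcc a b hab z.re) - p) univ :=
    hasLogOn_univ ((h.cont.comp hc).sub continuous_const) fun z hz =>
      hp ⟨_, Subtype.coe_prop _, sub_eq_zero.1 hz⟩
  have h2 : (fun z : ℂ => α z.re) '' ((fun t : ℝ => (t : ℂ)) '' Icc a b) = α '' Icc a b := by
    rw [image_image]; simp
  rw [← h2]
  refine HasLogOn.image (f := fun w => w - p)
    (isCompact_Icc.image Complex.continuous_ofReal)
    (h.cont.comp Complex.continuous_re).continuousOn ?_ ((h1.mono (subset_univ _)).congr ?_)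
  · rintro _ ⟨s, hs, rfl⟩ _ ⟨t, ht, rfl⟩ hst
    simp only [Complex.ofReal_re] at hst
    rw [h.inj (Icc_subset_Icc ha hb hs) (Icc_subset_Icc ha hb ht) hst]
  · rintro _ ⟨s, hs, rfl⟩
    simp [projIcc_of_mem hab hs]

lemma IsArcMap.isPreconnected_compl {α : ℝ → ℂ} (h : IsArcMap α) :
    IsPreconnected (α '' Icc 0 1)ᶜ :=
  h.isPreconnected_compl_image le_rfl zero_le_one le_rfl

/-- `z ↦ α 0 + 1 / F z` is a conformal map of the punctured disc onto the complement of the arc. -/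
structure IsExteriorMap (α : ℝ → ℂ) (F : ℂ → ℂ) : Prop where
  arc : IsArcMap α
  diff : DifferentiableOn ℂ F (ball 0 1)
  inj : InjOn F (ball 0 1)
  map_zero : F 0 = 0
  notMem : ∀ z ∈ ball (0 : ℂ) 1, z ≠ 0 → α 0 + (F z)⁻¹ ∉ α '' Icc 0 1
  surj : ∀ w ∉ α '' Icc 0 1, ∃ z ∈ ball (0 : ℂ) 1, z ≠ 0 ∧ α 0 + (F z)⁻¹ = w

lemma IsArcMap.exists_isExteriorMap {α : ℝ → ℂ} (h : IsArcMap α) :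
    ∃ F, IsExteriorMap α F := by
  set A := α '' Icc 0 1 with hA
  have h0A : α 0 ∈ A := ⟨0, by simp, rfl⟩
  set V : Set ℂ := {w | w = 0 ∨ α 0 + w⁻¹ ∉ A} with hV
  have h0V : (0 : ℂ) ∈ V := .inl rfl
  obtain ⟨r, hr⟩ := h.isCompact.isBounded.subset_closedBall (α 0)
  have hr0 : 0 ≤ r := nonempty_closedBall.1 ⟨_, hr h0A⟩
  have hVo : IsOpen V := by
    have hV' : V = ({w : ℂ | w ≠ 0} ∩ (fun w : ℂ => α 0 + w⁻¹) ⁻¹' Aᶜ) ∪ ball 0 (r + 1)⁻¹ := by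
      ext w
      constructor
      · rintro (rfl | hw)
        · exact .inr (mem_ball_self (by positivity))
        · by_cases h0 : w = 0
          · exact .inr (h0 ▸ mem_ball_self (by positivity))
          · exact .inl ⟨h0, hw⟩
      · rintro (⟨-, hw⟩ | hw)
        · exact .inr hw
        · by_cases h0 : w = 0
          · exact .inl h0
          · refine .inr fun hwA => ?_
            have h1 := hr hwA
            rw [mem_closedBall, dist_eq_norm, add_sub_cancel_left, norm_inv] at h1
            rw [mem_ball_zero_iff] at hw
            have h2 : 0 < ‖w‖ := norm_pos_iff.2 h0
            have h3 := (lt_inv_comm₀ h2 (by positivity)).1 hw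
            linarith
    rw [hV']
    refine IsOpen.union (ContinuousOn.isOpen_inter_preimage ?_ isOpen_ne
      h.isCompact.isClosed.isOpen_compl) isOpen_ball
    exact continuousOn_const.add (continuousOn_id.inv₀ fun w hw => hw)
  have hVc : IsConnected V := by
    refine ⟨⟨0, h0V⟩, ?_⟩
    have h1 : IsPreconnected ((fun x : ℂ => (x - α 0)⁻¹) '' Aᶜ) := by
      refine h.isPreconnected_compl.image _ ?_
      exact (continuousOn_id.sub continuousOn_const).inv₀ fun x hx h0 => by
        have h0' : x = α 0 := sub_eq_zero.1 h0
        exact hx (h0' ▸ h0A)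
    have hsub : V \ {0} ⊆ (fun x : ℂ => (x - α 0)⁻¹) '' Aᶜ := by
      rintro w ⟨rfl | hw, h0⟩
      · exact absurd rfl h0
      · exact ⟨_, hw, by simp⟩
    refine h1.subset_closure ?_ ?_
    · rintro _ ⟨x, hx, rfl⟩
      exact .inr (by simpa using hx)
    · refine subset_trans (fun w hw => ?_) (closure_mono hsub)
      by_cases h0 : w = 0
      · subst h0
        rw [Metric.mem_closure_iff]
        intro ε hε
        obtain ⟨v, hv, hv0⟩ := exists_mem_ne_of_mem_nhds
          (inter_mem (hVo.mem_nhds h0V) (ball_mem_nhds (0 : ℂ) hε))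
        exact ⟨v, ⟨hv.1, hv0⟩, by rw [dist_comm]; exact hv.2⟩
      · exact subset_closure ⟨hw, h0⟩
  have hne : ∀ t ∈ Ioc (0 : ℝ) 1, α t - α 0 ≠ 0 := fun t ht h0 =>
    ht.1.ne' (h.inj ⟨ht.1.le, ht.2⟩ (by simp) (sub_eq_zero.1 h0))
  have hR : Vᶜ = (fun t : ℝ => (α t - α 0)⁻¹) '' Ioc 0 1 := by
    ext w
    constructor
    · intro hw
      have h0 : w ≠ 0 := fun h0 => hw (.inl h0)
      obtain ⟨t, ht, htw⟩ : α 0 + w⁻¹ ∈ A := by by_contra h; exact hw (.inr h)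
      refine ⟨t, ⟨lt_of_le_of_ne ht.1 ?_, ht.2⟩, by simp [htw]⟩
      rintro rfl
      exact h0 (by simpa using htw)
    · rintro ⟨t, ht, rfl⟩ (h0 | h0)
      · exact hne t ht (by simpa using h0)
      · exact h0 ⟨t, ⟨ht.1.le, ht.2⟩, by simp⟩
  have hRc : IsPreconnected Vᶜ := by
    rw [hR]
    exact isPreconnected_Ioc.image _
      ((h.cont.continuousOn.sub continuousOn_const).inv₀ hne)
  have hRb : ¬ Bornology.IsBounded Vᶜ := by
    intro hb
    obtain ⟨C, hC0, hC⟩ := hb.exists_pos_norm_le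
    have hlim : Tendsto (fun t => α t - α 0) (𝓝[>] 0) (𝓝 0) := by
      have := (h.cont.tendsto 0).sub_const (α 0)
      rw [sub_self] at this
      exact this.mono_left nhdsWithin_le_nhds
    have hev := hlim.eventually (ball_mem_nhds (0 : ℂ) (inv_pos.2 hC0))
    obtain ⟨t, ht, ht1⟩ := (hev.and (Ioc_mem_nhdsGT (zero_lt_one' ℝ))).exists
    have h1 := hC ((α t - α 0)⁻¹) (by rw [hR]; exact ⟨t, ht1, rfl⟩)
    rw [dist_zero_right] at ht
    rw [norm_inv] at h1
    have h2 := norm_pos_iff.2 (hne t ht1)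
    have h3 := (lt_inv_comm₀ h2 hC0).1 ht
    linarith
  obtain ⟨f, hf, hf0, hfV⟩ := exists_isDiscMap_image_eq hVo hVc hRc hRb h0V
  obtain ⟨F, hF, hFi, hFV, hFf⟩ := exists_inverse hVo hf.diff hf.inj hfV
  have hF0 : F 0 = 0 := by
    have := hFf 0 h0V
    rwa [hf0] at this
  refine ⟨F, h, hF, hFi, hF0, fun z hz hz0 => ?_, fun w hw => ?_⟩
  · rcases (hFV ▸ mem_image_of_mem F hz : F z ∈ V) with h1 | h1
    · exact absurd (hFi hz (mem_ball_self one_pos) (h1.trans hF0.symm)) hz0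
    · exact h1
  · have h1 : (w - α 0)⁻¹ ∈ V := .inr (by rwa [inv_inv, add_sub_cancel])
    rw [← hFV] at h1
    obtain ⟨z, hz, hzw⟩ := h1
    refine ⟨z, hz, ?_, by rw [hzw]; simp⟩
    rintro rfl
    rw [hF0, eq_comm, inv_eq_zero, sub_eq_zero] at hzw
    exact hw (hzw ▸ h0A)

lemma lintegral_deriv_sq_eq {U : Set ℂ} (hU : IsOpen U) {ψ : ℂ → ℂ} (hψ : DifferentiableOn ℂ ψ U)
    (hinj : InjOn ψ U) : ∫⁻ z in U, ‖deriv ψ z‖ₑ ^ 2 = volume (ψ '' U) := by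
  rw [← lintegral_abs_det_fderiv_eq_addHaar_image volume hU.measurableSet
    (f' := fun z => (ContinuousLinearMap.toSpanSingleton ℂ (deriv ψ z)).restrictScalars ℝ)
    (fun z hz => ?_) hinj]
  · refine setLIntegral_congr_fun hU.measurableSet fun z _ => ?_
    have : ((ContinuousLinearMap.toSpanSingleton ℂ (deriv ψ z)).restrictScalars ℝ).det
        = ‖deriv ψ z‖ ^ 2 := by
      simp [ContinuousLinearMap.det, LinearMap.det_restrictScalars,
        Algebra.norm_complex_eq, Complex.normSq_eq_norm_sq]
    simp only [this]
    rw [abs_of_nonneg (by positivity), ENNReal.ofReal_pow (norm_nonneg _), ofReal_norm]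
  · exact ((hψ.differentiableAt (hU.mem_nhds hz)).hasDerivAt.hasFDerivAt.restrictScalars
      ℝ).hasFDerivWithinAt

end PlaneArc

namespace PlaneArc

open Filter Topology MeasureTheory Complex ENNReal

lemma exists_radius_lintegral_lt {G : ℂ → ℝ≥0∞} (hG : Measurable G) (hfin : ∫⁻ z, G z ≠ ⊤)
    {δ c : ℝ} (hδ : 0 < δ) (hc : 0 < c) :
    ∃ r ∈ Ioo 0 δ, ∫⁻ θ in Ioo (-Real.pi) Real.pi,
      ENNReal.ofReal r * (ENNReal.ofReal r * G (r * exp (θ * I))) < ENNReal.ofReal c := by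
  by_contra! hcon
  set a : ℝ → ℝ≥0∞ := fun r => ∫⁻ θ in Ioo (-Real.pi) Real.pi,
    ENNReal.ofReal r * G (r * exp (θ * I)) with ha
  have hmeas : Measurable fun p : ℝ × ℝ => ENNReal.ofReal p.1 * G (p.1 * exp (p.2 * I)) := by
    refine (ENNReal.measurable_ofReal.comp measurable_fst).mul (hG.comp ?_)
    exact (by fun_prop : Continuous fun p : ℝ × ℝ => (p.1 : ℂ) * exp (p.2 * I)).measurable
  have h1 : ∫⁻ r in Ioi 0, a r = ∫⁻ z, G z := by
    rw [← Complex.lintegral_comp_polarCoord_symm, _root_.polarCoord_target,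
      Measure.volume_eq_prod, setLIntegral_prod]
    · simp only [Complex.polarCoord_symm_apply, smul_eq_mul, ha, exp_mul_I, ofReal_cos, ofReal_sin]
    · simp only [Complex.polarCoord_symm_apply, smul_eq_mul, ofReal_cos, ofReal_sin, ← exp_mul_I]
      exact hmeas.aemeasurable
  have h2 : ∀ r ∈ Ioo 0 δ, ENNReal.ofReal c * ‖r⁻¹‖ₑ ≤ a r := fun r hr => by
    have h3 := hcon r hr
    rw [lintegral_const_mul' _ _ ENNReal.ofReal_ne_top] at h3
    rw [Real.enorm_eq_ofReal (inv_nonneg.2 hr.1.le), ENNReal.ofReal_inv_of_pos hr.1,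
      ← div_eq_mul_inv]
    exact ENNReal.div_le_of_le_mul' h3
  have h3 : ∫⁻ r in Ioo 0 δ, ENNReal.ofReal c * ‖r⁻¹‖ₑ < ⊤ := by
    refine lt_of_le_of_lt (setLIntegral_mono' measurableSet_Ioo h2) ?_
    refine lt_of_le_of_lt (lintegral_mono_set Ioo_subset_Ioi_self) ?_
    rw [h1]
    exact hfin.lt_top
  rw [lintegral_const_mul' _ _ ENNReal.ofReal_ne_top] at h3
  have h4 : ∫⁻ r in Ioo 0 δ, ‖r⁻¹‖ₑ < ⊤ := by
    refine lt_top_of_mul_ne_top_right h3.ne (by simpa using hc)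
  have h5 : IntervalIntegrable (fun x : ℝ => x⁻¹) volume 0 δ := by
    rw [intervalIntegrable_iff_integrableOn_Ioo_of_le hδ.le]
    exact ⟨measurable_inv.aestronglyMeasurable, h4⟩
  rw [intervalIntegrable_inv_iff] at h5
  rcases h5 with h5 | h5
  · exact hδ.ne h5
  · exact h5 left_mem_uIcc

lemma enorm_sub_le_lintegral_polar {U : Set ℂ} (hU : IsOpen U) {ψ : ℂ → ℂ}
    (hψ : DifferentiableOn ℂ ψ U) {r a b : ℝ} (hr : 0 < r) (hab : a ≤ b)
    (h : ∀ θ ∈ Icc a b, (r : ℂ) * exp (θ * I) ∈ U) :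
    ‖ψ (r * exp (b * I)) - ψ (r * exp (a * I))‖ₑ ≤
      ∫⁻ θ in Icc a b, ENNReal.ofReal r * ‖deriv ψ (r * exp (θ * I))‖ₑ := by
  have hγ : ∀ θ : ℝ, HasDerivAt (fun θ : ℝ => (r : ℂ) * exp (θ * I)) (r * (exp (θ * I) * I)) θ := by
    intro θ
    have h1 : HasDerivAt (fun θ : ℝ => (θ : ℂ) * I) I θ := by
      simpa using (Complex.ofRealCLM.hasDerivAt (x := θ)).mul_const I
    exact (h1.cexp).const_mul _
  have hγC : ContDiff ℝ 1 fun θ : ℝ => (r : ℂ) * exp (θ * I) := by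
    have : ContDiff ℝ 1 fun θ : ℝ => (θ : ℂ) * I := Complex.ofRealCLM.contDiff.mul contDiff_const
    exact contDiff_const.mul this.cexp
  have hψC : ContDiffOn ℝ 1 ψ U := (hψ.contDiffOn hU).restrict_scalars ℝ
  refine (enorm_sub_le_lintegral_deriv_of_contDiffOn_Icc
    (f := fun θ : ℝ => ψ ((r : ℂ) * exp (θ * I))) (hψC.comp hγC.contDiffOn h) hab).trans ?_
  refine (setLIntegral_congr_fun measurableSet_Icc fun θ hθ => ?_).le
  have hd := (hψ.differentiableAt (hU.mem_nhds (h θ hθ))).hasDerivAt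
  have := hd.scomp θ (hγ θ)
  simp only [Function.comp_def] at this
  rw [this.deriv, smul_eq_mul, enorm_mul, enorm_mul, enorm_mul]
  have e1 : ‖exp (θ * I)‖ₑ = 1 := by rw [← ofReal_norm, norm_exp_ofReal_mul_I]; simp
  have e2 : ‖(r : ℂ)‖ₑ = ENNReal.ofReal r := by
    rw [← ofReal_norm, Complex.norm_real, Real.norm_of_nonneg hr.le]
  have e3 : ‖I‖ₑ = 1 := by rw [← ofReal_norm, norm_I]; simp
  rw [e1, e2, e3, mul_one, mul_one]

lemma exists_radius_norm_sub_le {U : Set ℂ} (hU : IsOpen U) {ψ : ℂ → ℂ}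
    (hψ : DifferentiableOn ℂ ψ U) (hinj : InjOn ψ U) (hfin : volume (ψ '' U) ≠ ⊤)
    {η δ : ℝ} (hη : 0 < η) (hδ : 0 < δ) :
    ∃ r ∈ Ioo 0 δ, ∀ a b : ℝ, -Real.pi < a → a ≤ b → b < Real.pi →
      (∀ θ ∈ Icc a b, (r : ℂ) * exp (θ * I) ∈ U) →
      ‖ψ (r * exp (b * I)) - ψ (r * exp (a * I))‖ ≤ η := by
  have hπ := Real.pi_pos
  set k : ℝ := η / (4 * Real.pi) with hk
  have hk0 : 0 < k := by positivity
  set G : ℂ → ℝ≥0∞ := U.indicator fun z => ‖deriv ψ z‖ₑ ^ 2 with hG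
  have hGm : Measurable G :=
    ((measurable_deriv ψ).enorm.pow_const 2).indicator hU.measurableSet
  have hGf : ∫⁻ z, G z ≠ ⊤ := by
    rw [hG, lintegral_indicator hU.measurableSet, lintegral_deriv_sq_eq hU hψ hinj]
    exact hfin
  obtain ⟨r, hr, hlt⟩ := exists_radius_lintegral_lt hGm hGf hδ (c := k * (η / 2)) (by positivity)
  refine ⟨r, hr, fun a b ha hab hb h => ?_⟩
  have hamgm : ∀ x : ℝ≥0∞, x ≤ ENNReal.ofReal k + (ENNReal.ofReal k)⁻¹ * (x * x) := by
    intro x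
    by_cases hx : x ≤ ENNReal.ofReal k
    · exact hx.trans le_self_add
    · push Not at hx
      refine le_trans ?_ le_add_self
      calc x = (ENNReal.ofReal k)⁻¹ * (ENNReal.ofReal k * x) := by
            rw [← mul_assoc, ENNReal.inv_mul_cancel (by simpa using hk0) ENNReal.ofReal_ne_top,
              one_mul]
        _ ≤ _ := by gcongr
  have hsub : Icc a b ⊆ Ioo (-Real.pi) Real.pi := fun θ hθ =>
    ⟨ha.trans_le hθ.1, hθ.2.trans_lt hb⟩
  have key : ‖ψ (r * exp (b * I)) - ψ (r * exp (a * I))‖ₑ ≤ ENNReal.ofReal η := by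
    refine (enorm_sub_le_lintegral_polar hU hψ hr.1 hab h).trans ?_
    calc ∫⁻ θ in Icc a b, ENNReal.ofReal r * ‖deriv ψ (r * exp (θ * I))‖ₑ
        ≤ ∫⁻ θ in Icc a b, (ENNReal.ofReal k + (ENNReal.ofReal k)⁻¹ *
            (ENNReal.ofReal r * (ENNReal.ofReal r * G (r * exp (θ * I))))) := by
          refine setLIntegral_mono' measurableSet_Icc fun θ hθ => (hamgm _).trans (le_of_eq ?_)
          rw [hG, indicator_of_mem (h θ hθ)]
          ring
      _ ≤ ∫⁻ θ in Ioo (-Real.pi) Real.pi, (ENNReal.ofReal k + (ENNReal.ofReal k)⁻¹ *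
            (ENNReal.ofReal r * (ENNReal.ofReal r * G (r * exp (θ * I))))) :=
          lintegral_mono_set hsub
      _ = ENNReal.ofReal k * volume (Ioo (-Real.pi) Real.pi) + (ENNReal.ofReal k)⁻¹ *
            ∫⁻ θ in Ioo (-Real.pi) Real.pi,
              (ENNReal.ofReal r * (ENNReal.ofReal r * G (r * exp (θ * I)))) := by
          rw [lintegral_add_left measurable_const, setLIntegral_const,
            lintegral_const_mul' _ _ (by simpa using hk0)]
      _ ≤ ENNReal.ofReal (η / 2) + ENNReal.ofReal (η / 2) := by
          gcongr
          · rw [Real.volume_Ioo, ← ENNReal.ofReal_mul hk0.le]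
            refine ENNReal.ofReal_le_ofReal (le_of_eq ?_)
            rw [hk]; field_simp; ring
          · calc _ ≤ (ENNReal.ofReal k)⁻¹ * ENNReal.ofReal (k * (η / 2)) := by gcongr
              _ = _ := by
                rw [ENNReal.ofReal_mul hk0.le, ← mul_assoc,
                  ENNReal.inv_mul_cancel (by simpa using hk0) ENNReal.ofReal_ne_top, one_mul]
      _ = ENNReal.ofReal η := by
          rw [← ENNReal.ofReal_add (by positivity) (by positivity), add_halves]
  rwa [← ofReal_norm, ENNReal.ofReal_le_ofReal_iff hη.le] at key

end PlaneArc

namespace PlaneArc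

open Filter Topology MeasureTheory

/-- The conformal map of the punctured disc onto the complement of the arc `α` attached to `F`. -/
noncomputable def extMap (α : ℝ → ℂ) (F : ℂ → ℂ) (z : ℂ) : ℂ := α 0 + (F z)⁻¹

variable {α : ℝ → ℂ} {F : ℂ → ℂ}

lemma isOpen_puncturedBall : IsOpen (ball (0 : ℂ) 1 \ {0}) :=
  isOpen_ball.sdiff isClosed_singleton

namespace IsExteriorMap

lemma ne_zero (h : IsExteriorMap α F) {z : ℂ} (hz : z ∈ ball (0 : ℂ) 1 \ {0}) : F z ≠ 0 := fun h0 =>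
  hz.2 (h.inj hz.1 (mem_ball_self one_pos) (h0.trans h.map_zero.symm))

lemma differentiableOn_extMap (h : IsExteriorMap α F) :
    DifferentiableOn ℂ (extMap α F) (ball 0 1 \ {0}) :=
  (differentiableOn_const _).add ((h.diff.mono sdiff_subset).fun_inv fun _ hz => h.ne_zero hz)

lemma injOn_extMap (h : IsExteriorMap α F) : InjOn (extMap α F) (ball 0 1 \ {0}) :=
  fun _ hz _ hw hzw => h.inj hz.1 hw.1 (inv_injective (add_left_cancel hzw))

lemma image_extMap (h : IsExteriorMap α F) :
    extMap α F '' (ball 0 1 \ {0}) = (α '' Icc 0 1)ᶜ := by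
  ext w
  constructor
  · rintro ⟨z, hz, rfl⟩
    exact h.notMem z hz.1 hz.2
  · intro hw
    obtain ⟨z, hz, hz0, rfl⟩ := h.surj w hw
    exact ⟨z, ⟨hz, hz0⟩, rfl⟩

lemma isOpen_image_extMap (h : IsExteriorMap α F) {U : Set ℂ} (hU : IsOpen U)
    (hUD : U ⊆ ball 0 1 \ {0}) : IsOpen (extMap α F '' U) :=
  isOpen_image_of_injOn isOpen_puncturedBall h.differentiableOn_extMap h.injOn_extMap hU hUD

lemma exists_nhds_norm_le (h : IsExteriorMap α F) {w : ℂ} (hw : w ∉ α '' Icc 0 1) :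
    ∃ N ∈ 𝓝 w, ∃ ρ < 1, ∀ z ∈ ball (0 : ℂ) 1 \ {0}, extMap α F z ∈ N → ‖z‖ ≤ ρ := by
  obtain ⟨z₀, hz₀, rfl⟩ : w ∈ extMap α F '' (ball 0 1 \ {0}) := h.image_extMap ▸ hw
  have hz1 : ‖z₀‖ < 1 := mem_ball_zero_iff.1 hz₀.1
  have hO : IsOpen (ball (0 : ℂ) ((‖z₀‖ + 1) / 2) \ {0}) := isOpen_ball.sdiff isClosed_singleton
  have hsub : ball (0 : ℂ) ((‖z₀‖ + 1) / 2) \ {0} ⊆ ball 0 1 \ {0} :=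
    sdiff_subset_sdiff_left (ball_subset_ball (by linarith))
  refine ⟨_, (h.isOpen_image_extMap hO hsub).mem_nhds ⟨z₀, ⟨?_, hz₀.2⟩, rfl⟩, (‖z₀‖ + 1) / 2,
    by linarith, ?_⟩
  · rw [mem_ball_zero_iff]; linarith
  · rintro z hz ⟨z', hz', hzz⟩
    rw [← h.injOn_extMap (hsub hz') hz hzz]
    exact (mem_ball_zero_iff.1 hz'.1).le

lemma exists_norm_extMap_le (h : IsExteriorMap α F) {s : ℝ} (hs0 : 0 < s) (hs1 : s ≤ 1) :
    ∃ M, ∀ z ∈ ball (0 : ℂ) 1, s ≤ ‖z‖ → ‖extMap α F z‖ ≤ M := by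
  have h1 := isOpen_image_of_injOn isOpen_ball h.diff h.inj (isOpen_ball (x := 0) (ε := s))
    (ball_subset_ball hs1)
  obtain ⟨ε, hε, hb⟩ := Metric.isOpen_iff.1 h1 0 ⟨0, mem_ball_self hs0, h.map_zero⟩
  refine ⟨‖α 0‖ + ε⁻¹, fun z hz hsz => (norm_add_le _ _).trans ?_⟩
  gcongr
  rw [norm_inv]
  refine inv_anti₀ hε (not_lt.1 fun hlt => ?_)
  obtain ⟨z', hz', hzz⟩ := hb (mem_ball_zero_iff.2 hlt)
  have := h.inj (ball_subset_ball hs1 hz') hz hzz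
  rw [this, mem_ball_zero_iff] at hz'
  linarith

lemma exists_crosscut (h : IsExteriorMap α F) {ζ : ℂ} (hζ : ‖ζ‖ = 1) {η δ : ℝ} (hη : 0 < η)
    (hδ : 0 < δ) : ∃ r ∈ Ioo 0 δ, r < 1 / 2 ∧ ∀ z ∈ ball (0 : ℂ) 1, ∀ w ∈ ball (0 : ℂ) 1,
      ‖z - ζ‖ = r → ‖w - ζ‖ = r → ‖extMap α F z - extMap α F w‖ ≤ η := by
  have hζ0 : ζ ≠ 0 := norm_ne_zero_iff.1 (by rw [hζ]; exact one_ne_zero)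
  set U : Set ℂ := ball 1 1 ∩ ball 0 (1 / 2) with hU
  set T : ℂ → ℂ := fun u => ζ * (1 - u) with hT
  have hTd : Differentiable ℂ T := by fun_prop
  have hTU : MapsTo T U (ball 0 1 \ {0}) := by
    intro u hu
    have h1 : ‖u - 1‖ < 1 := mem_ball_iff_norm.1 hu.1
    have h2 : ‖u‖ < 1 / 2 := mem_ball_zero_iff.1 hu.2
    refine ⟨?_, ?_⟩
    · rw [mem_ball_zero_iff, norm_mul, hζ, one_mul, norm_sub_rev]
      exact h1
    · refine mul_ne_zero hζ0 fun h0 => ?_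
      rw [← sub_eq_zero.1 h0, norm_one] at h2
      norm_num at h2
  have hTn : ∀ u ∈ U, 1 / 2 ≤ ‖T u‖ := by
    intro u hu
    have h2 : ‖u‖ < 1 / 2 := mem_ball_zero_iff.1 hu.2
    rw [norm_mul, hζ, one_mul]
    have := norm_sub_norm_le (1 : ℂ) u
    rw [norm_one] at this
    linarith
  have hTi : Function.Injective T := fun u v huv =>
    sub_right_injective (mul_left_cancel₀ hζ0 huv)
  have hUo : IsOpen U := isOpen_ball.inter isOpen_ball
  obtain ⟨M, hM⟩ := h.exists_norm_extMap_le (s := 1 / 2) (by norm_num) (by norm_num)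
  have hfin : volume ((extMap α F ∘ T) '' U) ≠ ⊤ := by
    refine ((isBounded_closedBall (x := (0 : ℂ)) (r := M)).subset ?_).measure_lt_top.ne
    rintro _ ⟨u, hu, rfl⟩
    exact mem_closedBall_zero_iff.2 (hM _ (hTU hu).1 (hTn u hu))
  obtain ⟨r, hr, hrU⟩ := exists_radius_norm_sub_le hUo
    (h.differentiableOn_extMap.comp hTd.differentiableOn hTU)
    (h.injOn_extMap.comp hTi.injOn hTU) hfin hη (lt_min hδ (by norm_num : (0 : ℝ) < 1 / 2))
  have hr2 : r < 1 / 2 := hr.2.trans_le (min_le_right _ _)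
  refine ⟨r, ⟨hr.1, hr.2.trans_le (min_le_left _ _)⟩, hr2, ?_⟩
  have hcos : ∀ θ : ℝ, ‖(r : ℂ) * Complex.exp (θ * Complex.I) - 1‖ < 1 ↔ r / 2 < Real.cos θ := by
    intro θ
    rw [← sq_lt_one_iff₀ (norm_nonneg _), ← Complex.normSq_eq_norm_sq, Complex.normSq_apply,
      Complex.exp_mul_I, ← Complex.ofReal_cos, ← Complex.ofReal_sin]
    simp
    rw [← Complex.ofReal_cos, ← Complex.ofReal_sin, Complex.ofReal_re, Complex.ofReal_re,
      show (r * Real.cos θ - 1) * (r * Real.cos θ - 1) + r * Real.sin θ * (r * Real.sin θ)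
        = 1 - r * (2 * Real.cos θ - r) by linear_combination r ^ 2 * Real.sin_sq_add_cos_sq θ,
      sub_lt_self_iff, mul_pos_iff_of_pos_left hr.1]
    constructor <;> intro h1 <;> linarith
  have hmem : ∀ θ : ℝ, (r : ℂ) * Complex.exp (θ * Complex.I) ∈ U ↔ r / 2 < Real.cos θ := by
    intro θ
    rw [hU, mem_inter_iff, mem_ball_iff_norm, hcos, mem_ball_zero_iff, norm_mul,
      Complex.norm_exp_ofReal_mul_I, Complex.norm_real, Real.norm_of_nonneg hr.1.le]
    simp only [mul_one, and_iff_left_iff_imp]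
    exact fun _ => hr2
  have hpolar : ∀ z ∈ ball (0 : ℂ) 1, ‖z - ζ‖ = r → ∃ θ : ℝ, -Real.pi < θ ∧ θ < Real.pi ∧
      r / 2 < Real.cos θ ∧ z = T (r * Complex.exp (θ * Complex.I)) := by
    intro z hz hzr
    set u := 1 - z / ζ with hu
    have h1 : ζ * u = ζ - z := by rw [hu]; field_simp
    have hur : ‖u‖ = r := by
      rw [← hzr, norm_sub_rev z, ← h1, norm_mul, hζ, one_mul]
    have hue : (r : ℂ) * Complex.exp (u.arg * Complex.I) = u := by
      rw [← hur, Complex.norm_mul_exp_arg_mul_I]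
    have hc : r / 2 < Real.cos u.arg := by
      rw [← hcos, hue, hu, sub_sub_cancel_left, norm_neg, norm_div, hζ, div_one]
      exact mem_ball_zero_iff.1 hz
    refine ⟨u.arg, Complex.neg_pi_lt_arg u, lt_of_le_of_ne (Complex.arg_le_pi u) ?_, hc, ?_⟩
    · intro hpi
      rw [hpi, Real.cos_pi] at hc
      linarith [hr.1]
    · rw [hue, hT]
      simp only
      rw [mul_sub, h1]
      ring
  intro z hz w hw hzr hwr
  obtain ⟨a, ha, ha', hac, rfl⟩ := hpolar z hz hzr
  obtain ⟨b, hb, hb', hbc, rfl⟩ := hpolar w hw hwr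
  have key : ∀ a b : ℝ, -Real.pi < a → b < Real.pi → a ≤ b → r / 2 < Real.cos a →
      r / 2 < Real.cos b → ∀ θ ∈ Icc a b, (r : ℂ) * Complex.exp (θ * Complex.I) ∈ U := by
    intro a b ha hb hab hac hbc θ hθ
    rw [hmem, ← Real.cos_abs]
    rcases le_total 0 θ with h0 | h0
    · refine hbc.trans_le ?_
      rw [abs_of_nonneg h0]
      exact Real.cos_le_cos_of_nonneg_of_le_pi h0 hb.le hθ.2
    · refine hac.trans_le ?_
      rw [abs_of_nonpos h0, ← Real.cos_neg]
      exact Real.cos_le_cos_of_nonneg_of_le_pi (by linarith) (by linarith) (by linarith [hθ.1])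
  rcases le_total a b with hab | hab
  · rw [norm_sub_rev]
    exact hrU a b ha hab hb' (key a b ha hb' hab hac hbc)
  · exact hrU b a hb hab ha' (key b a hb ha' hab hbc hac)

end IsExteriorMap

end PlaneArc

namespace PlaneArc

open Filter Topology

lemma IsArcMap.exists_norm_sub_lt {α : ℝ → ℂ} (h : IsArcMap α) {δ : ℝ} (hδ : 0 < δ) :
    ∃ η > 0, ∀ s ∈ Icc (0 : ℝ) 1, ∀ t ∈ Icc (0 : ℝ) 1, ‖α s - α t‖ < η → |s - t| < δ := by
  have hK : IsCompact (Icc (0 : ℝ) 1 ×ˢ Icc (0 : ℝ) 1 ∩ {p : ℝ × ℝ | δ ≤ |p.1 - p.2|}) :=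
    (isCompact_Icc.prod isCompact_Icc).inter_right
      (isClosed_le continuous_const (by fun_prop))
  have hα := h.cont
  obtain ⟨η, hη, hle⟩ := hK.exists_forall_le' (f := fun p : ℝ × ℝ => ‖α p.1 - α p.2‖) (a := 0)
    (by fun_prop) fun p hp => by
      rw [norm_pos_iff, sub_ne_zero]
      intro h0
      have h1 := h.inj hp.1.1 hp.1.2 h0
      have h2 : δ ≤ |p.1 - p.2| := hp.2
      rw [h1, sub_self, abs_zero] at h2
      exact hδ.not_ge h2
  refine ⟨η, hη, fun s hs t ht hst => ?_⟩
  by_contra! hcon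
  exact (hle (s, t) ⟨⟨hs, ht⟩, hcon⟩).not_gt hst

lemma IsArcMap.exists_hull {α : ℝ → ℂ} (h : IsArcMap α) {ε : ℝ} (hε : 0 < ε) :
    ∃ η > 0, η ≤ ε ∧ ∀ T ⊆ Icc (0 : ℝ) 1, IsCompact T →
      (∀ s ∈ T, ∀ t ∈ T, ‖α s - α t‖ ≤ η) → ∃ H ⊆ Icc (0 : ℝ) 1, IsCompact H ∧
        IsPreconnected H ∧ T ⊆ H ∧ ∀ u ∈ H, ∃ s ∈ T, ‖α u - α s‖ ≤ ε := by
  obtain ⟨δ, hδ, hδε⟩ := Metric.uniformContinuousOn_iff.1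
    (isCompact_Icc.uniformContinuousOn_of_continuous (s := Icc (0 : ℝ) 1) h.cont.continuousOn) ε hε
  obtain ⟨η, hη, hηδ⟩ := h.exists_norm_sub_lt hδ
  refine ⟨min (η / 2) ε, by positivity, min_le_right _ _, fun T hT hTc hd => ?_⟩
  rcases T.eq_empty_or_nonempty with rfl | hne
  · exact ⟨∅, empty_subset _, isCompact_empty, isPreconnected_empty, Subset.rfl, by simp⟩
  have hi := hTc.sInf_mem hne
  have hs := hTc.sSup_mem hne
  refine ⟨Icc (sInf T) (sSup T), Icc_subset_Icc (hT hi).1 (hT hs).2, isCompact_Icc,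
    isPreconnected_Icc, fun t ht => ⟨csInf_le hTc.bddBelow ht, le_csSup hTc.bddAbove ht⟩,
    fun u hu => ⟨sInf T, hi, ?_⟩⟩
  have h1 := hηδ _ (hT hs) _ (hT hi)
    ((hd _ hs _ hi).trans_lt ((min_le_left _ _).trans_lt (half_lt_self hη)))
  rw [← dist_eq_norm]
  refine (hδε u (Icc_subset_Icc (hT hi).1 (hT hs).2 hu) _ (hT hi) ?_).le
  rw [Real.dist_eq]
  refine lt_of_le_of_lt ?_ h1
  exact abs_le_abs_of_nonneg (by linarith [hu.1]) (by linarith [hu.2])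

/-- `φ` is an open injection of the punctured disc whose image is the complement of the arc. -/
structure IsExt (α : ℝ → ℂ) (φ : ℂ → ℂ) : Prop where
  arc : IsArcMap α
  inj : InjOn φ (ball 0 1 \ {0})
  image : φ '' (ball 0 1 \ {0}) = (α '' Icc 0 1)ᶜ
  isOpen_image : ∀ U ⊆ ball 0 1 \ {0}, IsOpen U → IsOpen (φ '' U)

variable {α : ℝ → ℂ} {F φ : ℂ → ℂ}

lemma IsExteriorMap.isExt (h : IsExteriorMap α F) : IsExt α (extMap α F) :=
  ⟨h.arc, h.injOn_extMap, h.image_extMap, fun _ hU hUo => h.isOpen_image_extMap hUo hU⟩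

lemma IsExt.notMem (h : IsExt α φ) {z : ℂ} (hz : z ∈ ball (0 : ℂ) 1 \ {0}) :
    φ z ∉ α '' Icc 0 1 := by
  have : φ z ∈ (α '' Icc 0 1)ᶜ := h.image ▸ mem_image_of_mem φ hz
  exact this

lemma IsExt.not_joinedOff (h : IsExt α φ) {J O₁ O₂ : Set ℂ} (hJ : IsCompact J)
    (hAJ : IsPreconnected (α '' Icc 0 1 ∩ J)) (hO₁ : IsOpen O₁) (hO₂ : IsOpen O₂)
    (hD₁ : O₁ ⊆ ball 0 1 \ {0}) (hD₂ : O₂ ⊆ ball 0 1 \ {0}) (hd : Disjoint O₁ O₂)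
    (hcov : ∀ z ∈ ball (0 : ℂ) 1 \ {0}, φ z ∉ J → z ∈ O₁ ∪ O₂) {z w : ℂ} (hz : z ∈ O₁)
    (hw : w ∈ O₂) : ¬ JoinedOff J (φ z) (φ w) := by
  intro hj
  have hA : JoinedOff (α '' Icc 0 1) (φ z) (φ w) :=
    ⟨_, h.arc.isPreconnected_compl, Subset.rfl, h.notMem (hD₁ hz), h.notMem (hD₂ hw)⟩
  have hdisj : Disjoint (φ '' O₁) (φ '' O₂) :=
    disjoint_image_image fun a ha b hb hab =>
      disjoint_left.1 hd ha (h.inj (hD₁ ha) (hD₂ hb) hab ▸ hb)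
  have hmem := (JoinedOff.union h.arc.isCompact hJ hAJ hA hj).subset_of_isOpen
    (h.isOpen_image _ hD₁ hO₁) (h.isOpen_image _ hD₂ hO₂) hdisj (fun p hp => ?_)
    (mem_image_of_mem φ hz)
  · exact disjoint_left.1 hdisj hmem (mem_image_of_mem φ hw)
  · rw [mem_compl_iff, mem_union, not_or, ← mem_compl_iff, ← h.image] at hp
    obtain ⟨⟨z', hz', rfl⟩, hp⟩ := hp
    exact (hcov z' hz' hp).imp (mem_image_of_mem φ) (mem_image_of_mem φ)

lemma isPreconnected_compl_closedBall' (x : ℂ) (r : ℝ) : IsPreconnected (closedBall x r)ᶜ := by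
  convert (isPreconnected_compl_closedBall r).image (fun z => x + z) (by fun_prop) using 1
  ext z
  constructor
  · intro hz
    refine ⟨z - x, fun h => hz ?_, by simp⟩
    rwa [mem_closedBall_zero_iff, ← mem_closedBall_iff_norm] at h
  · rintro ⟨z, hz, rfl⟩ h
    apply hz
    rwa [mem_closedBall_iff_norm, add_sub_cancel_left, ← mem_closedBall_zero_iff] at h

namespace IsExteriorMap


lemma exists_ball_norm_sub_le (h : IsExteriorMap α F) {ζ : ℂ} (hζ : ‖ζ‖ = 1) {ε : ℝ}
    (hε : 0 < ε) : ∃ r > 0, ∀ z ∈ ball (0 : ℂ) 1 \ {0}, ∀ w ∈ ball (0 : ℂ) 1 \ {0},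
      ‖z - ζ‖ < r → ‖w - ζ‖ < r → ‖extMap α F z - extMap α F w‖ ≤ ε := by
  set φ := extMap α F with hφ
  set R := ε / 2 with hR
  have hR0 : 0 < R := half_pos hε
  obtain ⟨η, hη, hηR, hhull⟩ := h.arc.exists_hull (half_pos hR0)
  obtain ⟨r, hr, hr2, hcut⟩ := h.exists_crosscut hζ hη one_pos
  obtain ⟨M, hM⟩ := h.exists_norm_extMap_le (s := 1 / 2) (by norm_num) (by norm_num)
  set C := φ '' (ball 0 1 ∩ sphere ζ r) with hC
  have hCd : ∀ p ∈ closure C, ∀ q ∈ closure C, ‖p - q‖ ≤ η := by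
    have h1 : closure (C ×ˢ C) ⊆ {p : ℂ × ℂ | ‖p.1 - p.2‖ ≤ η} := by
      refine closure_minimal ?_ (isClosed_le (by fun_prop) continuous_const)
      rintro ⟨_, _⟩ ⟨⟨z, hz, rfl⟩, ⟨w, hw, rfl⟩⟩
      exact hcut z hz.1 w hw.1 (mem_sphere_iff_norm.1 hz.2) (mem_sphere_iff_norm.1 hw.2)
    rw [closure_prod_eq] at h1
    exact fun p hp q hq => h1 (mk_mem_prod hp hq)
  have hz₀ : ζ * (1 - r : ℝ) ∈ ball (0 : ℂ) 1 ∩ sphere ζ r := by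
    constructor
    · rw [mem_ball_zero_iff, norm_mul, hζ, one_mul, Complex.norm_real, Real.norm_of_nonneg
        (by linarith)]
      linarith [hr.1]
    · rw [mem_sphere_iff_norm, show ζ * (1 - r : ℝ) - ζ = -(ζ * r) by push_cast; ring, norm_neg,
        norm_mul, hζ, one_mul, Complex.norm_real, Real.norm_of_nonneg hr.1.le]
  set x := φ (ζ * (1 - r : ℝ)) with hx
  have hxC : x ∈ closure C := subset_closure (mem_image_of_mem φ hz₀)
  have hCc : IsCompact (closure C) := by
    refine Metric.isCompact_of_isClosed_isBounded isClosed_closure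
      ((isBounded_closedBall (x := x) (r := η)).subset fun p hp => ?_)
    exact mem_closedBall_iff_norm.2 (hCd p hp x hxC)
  set T := Icc (0 : ℝ) 1 ∩ α ⁻¹' closure C with hT
  obtain ⟨H, hHI, hHc, hHp, hTH, hH⟩ := hhull T inter_subset_left
    (isCompact_Icc.inter_right (isClosed_closure.preimage h.arc.cont))
    fun s hs t ht => hCd _ hs.2 _ ht.2
  set J := closure C ∪ α '' H with hJ
  have hJx : J ⊆ closedBall x R := by
    rintro p (hp | ⟨u, hu, rfl⟩)
    · exact mem_closedBall_iff_norm.2 ((hCd p hp x hxC).trans (by linarith))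
    · obtain ⟨s, hs, hus⟩ := hH u hu
      rw [mem_closedBall_iff_norm]
      calc ‖α u - x‖ = ‖(α u - α s) + (α s - x)‖ := by rw [sub_add_sub_cancel]
        _ ≤ R / 2 + R / 2 := (norm_add_le _ _).trans
          (add_le_add hus ((hCd _ hs.2 x hxC).trans hηR))
        _ = R := add_halves R
  have hAJ : α '' Icc 0 1 ∩ J = α '' H := by
    refine Subset.antisymm ?_ fun p hp => ⟨image_mono hHI hp, .inr hp⟩
    rintro _ ⟨⟨t, ht, rfl⟩, hp | hp⟩
    · exact mem_image_of_mem α (hTH ⟨ht, hp⟩)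
    · exact hp
  obtain ⟨ρ, hρ⟩ := ((h.arc.isCompact.isBounded.union (isBounded_closedBall (x := (0 : ℂ))
    (r := M))).union (isBounded_closedBall (x := x) (r := R))).subset_closedBall 0
  obtain ⟨q, hq⟩ := NormedSpace.exists_lt_norm ℂ ℂ ρ
  have hqρ : q ∉ closedBall (0 : ℂ) ρ := fun hq' => hq.not_ge (mem_closedBall_zero_iff.1 hq')
  obtain ⟨zq, hzq, rfl⟩ : q ∈ φ '' (ball 0 1 \ {0}) :=
    h.image_extMap ▸ fun hqA => hqρ (hρ (.inl (.inl hqA)))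
  have hzq2 : ‖zq‖ < 1 / 2 := by
    by_contra! hcon
    exact hqρ (hρ (.inl (.inr (mem_closedBall_zero_iff.2 (hM zq hzq.1 hcon)))))
  have hmain : ∀ z ∈ ball (0 : ℂ) 1 \ {0}, ‖z - ζ‖ < r → φ z ∈ closedBall x R := by
    intro z hz hzr
    by_contra hcon
    refine h.isExt.not_joinedOff (J := J) (hCc.union (hHc.image h.arc.cont))
      (by rw [hAJ]; exact hHp.image _ h.arc.cont.continuousOn)
      (isOpen_puncturedBall.inter isOpen_ball)
      (isOpen_puncturedBall.inter (isClosed_closedBall (x := ζ) (ε := r)).isOpen_compl)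
      inter_subset_left inter_subset_left ?_ ?_ ⟨hz, mem_ball_iff_norm.2 hzr⟩ (w := zq)
      ⟨hzq, ?_⟩ ⟨_, isPreconnected_compl_closedBall' x R, compl_subset_compl.2 hJx, hcon,
        fun hq' => hqρ (hρ (.inr hq'))⟩
    · exact disjoint_left.2 fun u hu hu' => hu'.2 (ball_subset_closedBall hu.2)
    · intro u hu huJ
      rcases lt_trichotomy ‖u - ζ‖ r with h1 | h1 | h1
      · exact .inl ⟨hu, mem_ball_iff_norm.2 h1⟩
      · exact absurd (.inl (subset_closure ⟨u, ⟨hu.1, mem_sphere_iff_norm.2 h1⟩, rfl⟩)) huJ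
      · exact .inr ⟨hu, fun h2 => h1.not_ge (mem_closedBall_iff_norm.1 h2)⟩
    · intro h2
      rw [mem_closedBall_iff_norm'] at h2
      have := norm_sub_norm_le ζ zq
      linarith
  refine ⟨r, hr.1, fun z hz w hw hzr hwr => ?_⟩
  have h1 := mem_closedBall_iff_norm.1 (hmain z hz hzr)
  have h2 := mem_closedBall_iff_norm'.1 (hmain w hw hwr)
  calc ‖φ z - φ w‖ = ‖(φ z - x) + (x - φ w)‖ := by rw [sub_add_sub_cancel]
    _ ≤ R + R := (norm_add_le _ _).trans (add_le_add h1 h2)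
    _ = ε := add_halves ε

end IsExteriorMap

end PlaneArc

namespace PlaneArc

open Filter Topology

/-- `φ` is a continuous map of the closed punctured disc onto the plane that is injective in the
interior and folds the unit circle onto the arc `α`. -/
structure IsBoundaryExt (α : ℝ → ℂ) (φ : ℂ → ℂ) : Prop extends IsExt α φ where
  cont : ContinuousOn φ (closedBall 0 1 \ {0})
  image_sphere : φ '' sphere 0 1 = α '' Icc 0 1
  tendsto : Tendsto φ (𝓝[≠] 0) (Bornology.cobounded ℂ)
  not_const : ∀ ζ ∈ sphere (0 : ℂ) 1, ∀ r > 0, ∃ z ∈ sphere (0 : ℂ) 1, ‖z - ζ‖ < r ∧ φ z ≠ φ ζ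

lemma IsArcMap.exists_inverse {α : ℝ → ℂ} (h : IsArcMap α) :
    ∃ β : ℂ → ℝ, ContinuousOn β (α '' Icc 0 1) ∧ ∀ t ∈ Icc (0 : ℝ) 1, β (α t) = t := by
  have hβ : ∀ t ∈ Icc (0 : ℝ) 1, Function.invFunOn α (Icc 0 1) (α t) = t :=
    fun t ht => h.inj.leftInvOn_invFunOn ht
  refine ⟨Function.invFunOn α (Icc 0 1), ?_, hβ⟩
  rw [Metric.continuousOn_iff]
  rintro _ ⟨t, ht, rfl⟩ ε hε
  obtain ⟨η, hη, hlt⟩ := h.exists_norm_sub_lt hε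
  refine ⟨η, hη, ?_⟩
  rintro _ ⟨s, hs, rfl⟩ hst
  rw [hβ t ht, hβ s hs]
  exact hlt s hs t ht (by rwa [← dist_eq_norm])

lemma closedBall_diff_subset_closure :
    closedBall (0 : ℂ) 1 \ {0} ⊆ closure (ball (0 : ℂ) 1 \ {0}) := by
  intro z hz
  have h1 : (1 : ℝ) ∈ closure (Ioo (0 : ℝ) 1) := by
    rw [closure_Ioo zero_ne_one]; simp
  have h2 := map_mem_closure (f := fun t : ℝ => t • z) (t := ball (0 : ℂ) 1 \ {0})
    (by fun_prop) h1 fun t ht => ?_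
  · simpa using h2
  · refine ⟨?_, smul_ne_zero ht.1.ne' hz.2⟩
    rw [mem_ball_zero_iff, norm_smul, Real.norm_of_nonneg ht.1.le]
    have := mem_closedBall_zero_iff.1 hz.1
    nlinarith [ht.1, ht.2, norm_nonneg z]

lemma sphere_subset_closedBall_diff : sphere (0 : ℂ) 1 ⊆ closedBall 0 1 \ {0} := fun _ hz =>
  ⟨sphere_subset_closedBall hz, ne_of_mem_sphere hz one_ne_zero⟩

lemma ball_diff_subset : ball (0 : ℂ) 1 \ {0} ⊆ closedBall 0 1 \ {0} :=
  sdiff_subset_sdiff_left ball_subset_closedBall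

lemma mem_ball_diff_or_mem_sphere {z : ℂ} (hz : z ∈ closedBall (0 : ℂ) 1 \ {0}) :
    z ∈ ball (0 : ℂ) 1 \ {0} ∨ z ∈ sphere (0 : ℂ) 1 := by
  rcases (mem_closedBall.1 hz.1).lt_or_eq with h | h
  · exact .inl ⟨h, hz.2⟩
  · exact .inr h

lemma isClosed_image_of_tendsto_cobounded {φ : ℂ → ℂ}
    (hc : ContinuousOn φ (closedBall 0 1 \ {0}))
    (ht : Tendsto φ (𝓝[≠] 0) (Bornology.cobounded ℂ)) :
    IsClosed (φ '' (closedBall 0 1 \ {0})) := by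
  refine isClosed_of_closure_subset fun w hw => ?_
  have h1 : ∀ᶠ z in 𝓝[≠] (0 : ℂ), φ z ∉ ball w 1 :=
    ht.eventually (Bornology.isBounded_def.1 (isBounded_ball (x := w) (r := 1)))
  rw [eventually_nhdsWithin_iff, Metric.eventually_nhds_iff_ball] at h1
  obtain ⟨s, hs, hsb⟩ := h1
  have hK : IsCompact (closedBall (0 : ℂ) 1 \ ball 0 s) :=
    (isCompact_closedBall _ _).diff isOpen_ball
  have hsub : closedBall (0 : ℂ) 1 \ ball 0 s ⊆ closedBall 0 1 \ {0} :=
    sdiff_subset_sdiff_right (singleton_subset_iff.2 (mem_ball_self hs))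
  have h2 : w ∈ closure (φ '' (closedBall 0 1 \ ball 0 s)) := by
    rw [mem_closure_iff_nhds] at hw ⊢
    intro N hN
    obtain ⟨_, hp, z, hz, rfl⟩ := hw _ (inter_mem hN (ball_mem_nhds w one_pos))
    exact ⟨φ z, hp.1, z, ⟨hz.1, fun hzs => hsb z hzs hz.2 hp.2⟩, rfl⟩
  rw [(hK.image_of_continuousOn (hc.mono hsub)).isClosed.closure_eq] at h2
  exact image_mono hsub h2

/-- The continuous extension of `extMap` to the closed disc. -/
noncomputable def bdryExt (α : ℝ → ℂ) (F : ℂ → ℂ) : ℂ → ℂ :=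
  extendFrom (ball 0 1 \ {0}) (extMap α F)

namespace IsExteriorMap

variable {α : ℝ → ℂ} {F : ℂ → ℂ}

lemma bdryExt_eqOn (h : IsExteriorMap α F) :
    EqOn (bdryExt α F) (extMap α F) (ball 0 1 \ {0}) :=
  extendFrom_extends h.differentiableOn_extMap.continuousOn

lemma exists_tendsto (h : IsExteriorMap α F) {z : ℂ} (hz : z ∈ closedBall (0 : ℂ) 1 \ {0}) :
    ∃ y, Tendsto (extMap α F) (𝓝[ball 0 1 \ {0}] z) (𝓝 y) := by
  rcases mem_ball_diff_or_mem_sphere hz with hz' | hz'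
  · exact ⟨_, h.differentiableOn_extMap.continuousOn z hz'⟩
  · have : (𝓝[ball 0 1 \ {0}] z).NeBot :=
      mem_closure_iff_nhdsWithin_neBot.1 (closedBall_diff_subset_closure hz)
    rw [← cauchy_map_iff_exists_tendsto, Metric.cauchy_iff]
    refine ⟨inferInstance, fun ε hε => ?_⟩
    obtain ⟨r, hr, hle⟩ := h.exists_ball_norm_sub_le (mem_sphere_zero_iff_norm.1 hz')
      (half_pos hε)
    refine ⟨_, image_mem_map (inter_mem self_mem_nhdsWithin
      (mem_nhdsWithin_of_mem_nhds (ball_mem_nhds z hr))), ?_⟩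
    rintro _ ⟨x, hx, rfl⟩ _ ⟨y, hy, rfl⟩
    rw [dist_eq_norm]
    exact (hle x hx.1 y hy.1 (mem_ball_iff_norm.1 hx.2) (mem_ball_iff_norm.1 hy.2)).trans_lt
      (half_lt_self hε)

lemma continuousOn_bdryExt (h : IsExteriorMap α F) :
    ContinuousOn (bdryExt α F) (closedBall 0 1 \ {0}) :=
  continuousOn_extendFrom closedBall_diff_subset_closure fun _ hz => h.exists_tendsto hz

lemma isExt_bdryExt (h : IsExteriorMap α F) : IsExt α (bdryExt α F) where
  arc := h.arc
  inj := h.injOn_extMap.congr h.bdryExt_eqOn.symm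
  image := by rw [h.bdryExt_eqOn.image_eq, h.image_extMap]
  isOpen_image U hU hUo := by
    rw [(h.bdryExt_eqOn.mono hU).image_eq]; exact h.isOpen_image_extMap hUo hU

lemma tendsto_bdryExt (h : IsExteriorMap α F) :
    Tendsto (bdryExt α F) (𝓝[≠] 0) (Bornology.cobounded ℂ) := by
  have hball : ∀ᶠ z in 𝓝[≠] (0 : ℂ), z ∈ ball (0 : ℂ) 1 \ {0} :=
    inter_mem (mem_nhdsWithin_of_mem_nhds (ball_mem_nhds 0 one_pos)) self_mem_nhdsWithin
  have h1 : Tendsto F (𝓝[≠] 0) (𝓝[≠] 0) := by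
    refine tendsto_nhdsWithin_iff.2 ⟨?_, hball.mono fun z hz => h.ne_zero hz⟩
    have := (h.diff.continuousOn.continuousAt (ball_mem_nhds 0 one_pos)).tendsto
    rw [h.map_zero] at this
    exact this.mono_left nhdsWithin_le_nhds
  refine ((tendsto_const_add_cobounded (α 0)).comp (tendsto_inv₀_nhdsNE_zero.comp h1)).congr' ?_
  exact hball.mono fun z hz => (h.bdryExt_eqOn hz).symm

lemma bdryExt_mem (h : IsExteriorMap α F) {z : ℂ} (hz : z ∈ sphere (0 : ℂ) 1) :
    bdryExt α F z ∈ α '' Icc 0 1 := by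
  by_contra hcon
  have hz' := sphere_subset_closedBall_diff hz
  obtain ⟨N, hN, ρ, hρ, hle⟩ := h.exists_nhds_norm_le hcon
  have : (𝓝[ball 0 1 \ {0}] z).NeBot :=
    mem_closure_iff_nhdsWithin_neBot.1 (closedBall_diff_subset_closure hz')
  have h1 : ∀ᶠ w in 𝓝[ball 0 1 \ {0}] z, bdryExt α F w ∈ N :=
    ((h.continuousOn_bdryExt z hz').mono ball_diff_subset) hN
  have h2 : ∀ᶠ w in 𝓝[ball 0 1 \ {0}] z, ρ < ‖w‖ := by
    refine mem_nhdsWithin_of_mem_nhds ((continuous_norm.tendsto z).eventually_const_lt ?_)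
    rwa [mem_sphere_zero_iff_norm.1 hz]
  obtain ⟨w, ⟨hw1, hw2⟩, hw⟩ := ((h1.and h2).and self_mem_nhdsWithin).exists
  rw [h.bdryExt_eqOn hw] at hw1
  exact hw2.not_ge (hle w hw hw1)

lemma image_sphere_bdryExt (h : IsExteriorMap α F) :
    bdryExt α F '' sphere 0 1 = α '' Icc 0 1 := by
  have hsub : bdryExt α F '' sphere 0 1 ⊆ α '' Icc 0 1 := image_subset_iff.2 fun z hz =>
    h.bdryExt_mem hz
  refine Subset.antisymm hsub ?_
  set K := bdryExt α F '' sphere 0 1 with hK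
  have hcs := h.continuousOn_bdryExt.mono sphere_subset_closedBall_diff
  have hKc : IsCompact K := (isCompact_sphere 0 1).image_of_continuousOn hcs
  have hKp : IsConnected K := by
    refine IsConnected.image ?_ _ hcs
    exact isConnected_sphere (by simp [Complex.rank_real_complex]) 0 zero_le_one
  obtain ⟨β, hβc, hβ⟩ := h.arc.exists_inverse
  have hH : β '' K = Icc (sInf (β '' K)) (sSup (β '' K)) :=
    eq_Icc_of_connected_compact (hKp.image _ (hβc.mono hsub))
      (hKc.image_of_continuousOn (hβc.mono hsub))
  have hHI : β '' K ⊆ Icc 0 1 := by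
    rintro _ ⟨p, hp, rfl⟩
    obtain ⟨t, ht, rfl⟩ := hsub hp
    rwa [hβ t ht]
  have hKH : K = α '' (β '' K) := by
    ext p
    constructor
    · intro hp
      refine ⟨β p, mem_image_of_mem β hp, ?_⟩
      obtain ⟨t, ht, rfl⟩ := hsub hp
      rw [hβ t ht]
    · rintro ⟨_, ⟨p, hp, rfl⟩, rfl⟩
      obtain ⟨t, ht, rfl⟩ := hsub hp
      rwa [hβ t ht]
  have hne : sInf (β '' K) ≤ sSup (β '' K) := by
    rw [← nonempty_Icc, ← hH]
    exact hKp.nonempty.image _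
  have hKp : IsPreconnected Kᶜ := by
    rw [hKH, hH]
    exact h.arc.isPreconnected_compl_image (hHI ((Set.ext_iff.1 hH _).2 (left_mem_Icc.2 hne))).1 hne
      (hHI ((Set.ext_iff.1 hH _).2 (right_mem_Icc.2 hne))).2
  have hcl : closure (α '' Icc 0 1)ᶜ ⊆ (α '' Icc 0 1)ᶜ ∪ K := by
    refine closure_minimal subset_union_left ?_
    convert isClosed_image_of_tendsto_cobounded h.continuousOn_bdryExt h.tendsto_bdryExt using 1
    rw [← h.isExt_bdryExt.image, hK, ← image_union]
    congr 1
    ext z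
    exact ⟨fun hz => hz.elim (fun hz => ball_diff_subset hz)
      fun hz => sphere_subset_closedBall_diff hz, mem_ball_diff_or_mem_sphere⟩
  have hAc : (α '' Icc 0 1)ᶜ.Nonempty := by
    rw [← h.image_extMap]
    exact ⟨_, 1 / 2, ⟨by rw [mem_ball_zero_iff]; norm_num, by simp⟩, rfl⟩
  have hfin := IsPreconnected.subset_left_of_subset_union h.arc.isCompact.isClosed.isOpen_compl
    isClosed_closure.isOpen_compl
    (disjoint_left.2 fun w hw hw' => hw' (subset_closure hw)) (s := Kᶜ)
    (fun w hw => ?_) ?_ hKp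
  · exact compl_subset_compl.1 hfin
  · by_contra hcon
    rw [mem_union, not_or, notMem_compl_iff, notMem_compl_iff] at hcon
    exact (hcl hcon.2).elim (fun h1 => h1 hcon.1) hw
  · obtain ⟨w, hw⟩ := hAc
    exact ⟨w, fun hwK => hw (hsub hwK), hw⟩

lemma deriv_ne_zero (h : IsExteriorMap α F) : deriv F 0 ≠ 0 := by
  obtain ⟨g, hg, -, -, hgF⟩ := PlaneArc.exists_inverse isOpen_ball h.diff h.inj rfl
  have h0 := mem_ball_self (x := (0 : ℂ)) (one_pos (α := ℝ))
  have hF := (h.diff.differentiableAt (isOpen_ball.mem_nhds h0)).hasDerivAt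
  have hW := isOpen_image_of_injOn isOpen_ball h.diff h.inj isOpen_ball subset_rfl
  have hG := (hg.differentiableAt (hW.mem_nhds (mem_image_of_mem F h0))).hasDerivAt
  have h1 := hG.comp 0 hF
  have h2 : HasDerivAt (g ∘ F) 1 0 := (hasDerivAt_id (0 : ℂ)).congr_of_eventuallyEq
    (eventually_of_mem (isOpen_ball.mem_nhds h0) fun z hz => hgF z hz)
  intro h3
  rw [h3, mul_zero] at h1
  exact zero_ne_one (h1.unique h2)

lemma eq_zero_of_sphere {G : ℂ → ℂ} (hG : DiffContOnCl ℂ G (ball 0 1))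
    (h0 : ∀ z ∈ sphere (0 : ℂ) 1, G z = 0) : G 0 = 0 := by
  have := Complex.norm_le_of_forall_mem_frontier_norm_le isBounded_ball hG (C := 0)
    (fun z hz => by rw [h0 z (frontier_ball_subset_sphere hz), norm_zero])
    (subset_closure (mem_ball_self one_pos))
  exact norm_le_zero_iff.1 this

/-- A function holomorphic in the disc and continuous up to the boundary that vanishes on an arc of
the circle vanishes at the centre. -/
lemma eq_zero_of_arc {G : ℂ → ℂ} (hG : DiffContOnCl ℂ G (ball 0 1)) {ζ : ℂ}
    (hζ : ζ ∈ sphere (0 : ℂ) 1) {r : ℝ} (hr : 0 < r)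
    (h0 : ∀ z ∈ sphere (0 : ℂ) 1, ‖z - ζ‖ < r → G z = 0) : G 0 = 0 := by
  have hζ0 := ne_of_mem_sphere hζ one_ne_zero
  rw [mem_sphere_zero_iff_norm] at hζ
  obtain ⟨t, hts, htc⟩ := (isCompact_sphere (0 : ℂ) 1).elim_nhds_subcover
    (fun u => (fun w => ζ / u * w) ⁻¹' ball ζ r) fun u hu =>
      (isOpen_ball.preimage (by fun_prop)).mem_nhds (by
        have : ζ / u * u = ζ := div_mul_cancel₀ _ (ne_of_mem_sphere hu one_ne_zero)
        simpa [this] using hr)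
  have hmaps : ∀ u ∈ t, ∀ s : ℝ, MapsTo (fun w => ζ / u * w) (ball (0 : ℂ) s) (ball 0 s) := by
    intro u hu s w hw
    have hu1 := mem_sphere_zero_iff_norm.1 (hts u hu)
    rw [mem_ball_zero_iff] at hw ⊢
    rwa [norm_mul, norm_div, hζ, hu1, div_one, one_mul]
  have hprod : DiffContOnCl ℂ (fun w => ∏ u ∈ t, G (ζ / u * w)) (ball 0 1) := by
    have h1 : ∀ u ∈ t, DiffContOnCl ℂ (fun w => G (ζ / u * w)) (ball 0 1) := fun u hu =>
      hG.comp (Differentiable.diffContOnCl (by fun_prop)) (hmaps u hu 1)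
    refine ⟨DifferentiableOn.fun_finsetProd fun u hu => (h1 u hu).differentiableOn,
      continuousOn_finsetProd _ fun u hu => (h1 u hu).continuousOn⟩
  have := eq_zero_of_sphere hprod fun z hz => ?_
  · simp only [mul_zero, Finset.prod_const] at this
    exact eq_zero_of_pow_eq_zero this
  · obtain ⟨u, hu, hzu⟩ := mem_iUnion₂.1 (htc hz)
    refine Finset.prod_eq_zero hu (h0 _ ?_ (mem_ball_iff_norm.1 hzu))
    have hu1 := mem_sphere_zero_iff_norm.1 (hts u hu)
    rw [mem_sphere_zero_iff_norm] at hz ⊢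
    rw [norm_mul, norm_div, hζ, hu1, hz, div_one, one_mul]

lemma bdryExt_not_const (h : IsExteriorMap α F) {ζ : ℂ} (hζ : ζ ∈ sphere (0 : ℂ) 1) {r : ℝ}
    (hr : 0 < r) : ∃ z ∈ sphere (0 : ℂ) 1, ‖z - ζ‖ < r ∧ bdryExt α F z ≠ bdryExt α F ζ := by
  by_contra! hcon
  set p := bdryExt α F ζ with hp
  have hb0 := isOpen_ball.mem_nhds (mem_ball_self (x := (0 : ℂ)) (one_pos (α := ℝ)))
  set k := dslope F 0 with hk
  have hkd : DifferentiableOn ℂ k (ball 0 1) := (Complex.differentiableOn_dslope hb0).2 h.diff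
  have hkne : ∀ z ∈ ball (0 : ℂ) 1 \ {0}, k z = F z / z := fun z hz => by
    rw [hk, dslope_of_ne _ hz.2, slope_def_field, h.map_zero, sub_zero, sub_zero]
  have hk0 : ∀ z ∈ ball (0 : ℂ) 1, k z ≠ 0 := by
    intro z hz
    by_cases hz0 : z = 0
    · rw [hz0, hk, dslope_same]; exact h.deriv_ne_zero
    · rw [hkne z ⟨hz, hz0⟩]; exact div_ne_zero (h.ne_zero ⟨hz, hz0⟩) hz0
  set G : ℂ → ℂ := fun z => if z = 0 then (k 0)⁻¹ else z * (bdryExt α F z - p) with hG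
  have hGeq : EqOn G (fun z => z * (α 0 - p) + (k z)⁻¹) (ball 0 1) := by
    intro z hz
    by_cases hz0 : z = 0
    · simp [hG, hz0]
    · simp only [hG, if_neg hz0]
      rw [h.bdryExt_eqOn ⟨hz, hz0⟩, hkne z ⟨hz, hz0⟩, extMap]
      have := h.ne_zero ⟨hz, hz0⟩
      field_simp
      ring
  have hGd : DifferentiableOn ℂ G (ball 0 1) := by
    refine DifferentiableOn.congr ?_ hGeq
    exact (differentiableOn_id.mul_const _).add (hkd.fun_inv hk0)
  have hGc : ContinuousOn G (closedBall 0 1) := by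
    intro z hz
    by_cases hz1 : z ∈ ball (0 : ℂ) 1
    · exact (hGd.continuousOn.continuousAt (isOpen_ball.mem_nhds hz1)).continuousWithinAt
    · have hz0 : z ≠ 0 := fun h0 => hz1 (h0 ▸ mem_ball_self one_pos)
      have h1 : ContinuousWithinAt (fun z => z * (bdryExt α F z - p)) (closedBall 0 1 \ {0}) z :=
        continuousWithinAt_id.mul ((h.continuousOn_bdryExt z ⟨hz, hz0⟩).sub
          continuousWithinAt_const)
      have h2 : ContinuousWithinAt G (closedBall 0 1 \ {0}) z :=
        h1.congr (fun w hw => by simp only [hG]; exact if_neg hw.2)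
          (by simp only [hG]; rw [if_neg hz0])
      refine h2.mono_of_mem_nhdsWithin ?_
      exact inter_mem self_mem_nhdsWithin (mem_nhdsWithin_of_mem_nhds (isOpen_ne.mem_nhds hz0))
  have hG0 := eq_zero_of_arc (G := G) ⟨hGd, by rwa [closure_ball _ one_ne_zero]⟩ hζ hr
    fun z hz hzr => by
      simp only [hG]
      rw [if_neg (ne_of_mem_sphere hz one_ne_zero), hcon z hz hzr, sub_self, mul_zero]
  simp only [hG, if_true, inv_eq_zero] at hG0
  exact hk0 0 (mem_ball_self one_pos) hG0

lemma isBoundaryExt (h : IsExteriorMap α F) : IsBoundaryExt α (bdryExt α F) where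
  toIsExt := h.isExt_bdryExt
  cont := h.continuousOn_bdryExt
  image_sphere := h.image_sphere_bdryExt
  tendsto := h.tendsto_bdryExt
  not_const _ hζ _ hr := h.bdryExt_not_const hζ hr

end IsExteriorMap

lemma IsArcMap.exists_isBoundaryExt {α : ℝ → ℂ} (h : IsArcMap α) : ∃ φ, IsBoundaryExt α φ :=
  let ⟨_, hF⟩ := h.exists_isExteriorMap
  ⟨_, hF.isBoundaryExt⟩

end PlaneArc

namespace PlaneArc

open Filter Topology ComplexConjugate

/-- Twice the signed area of the triangle `a c b`. -/
noncomputable def sd (a b c : ℂ) : ℝ := ((c - a) * conj (b - a)).im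

lemma sd_swap (a b c : ℂ) : sd b a c = -sd a b c := by
  simp only [sd, Complex.mul_im, Complex.sub_re, Complex.sub_im, Complex.conj_re, Complex.conj_im]
  ring

lemma sd_left (a b : ℂ) : sd a b a = 0 := by simp [sd]

lemma continuous_sd (a b : ℂ) : Continuous (sd a b) :=
  Complex.continuous_im.comp ((continuous_id.sub continuous_const).mul continuous_const)

lemma ne_zero_of_norm_eq_one {a : ℂ} (ha : ‖a‖ = 1) : a ≠ 0 :=
  norm_ne_zero_iff.1 (ha ▸ one_ne_zero)

lemma sd_eq {a b c : ℂ} (ha : ‖a‖ = 1) (hb : ‖b‖ = 1) (hc : ‖c‖ = 1) :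
    (sd a b c : ℂ) * (2 * Complex.I) = -((a - b) * (b - c) * (c - a)) / (a * b * c) := by
  have ha0 := ne_zero_of_norm_eq_one ha
  have hb0 := ne_zero_of_norm_eq_one hb
  have hc0 := ne_zero_of_norm_eq_one hc
  have h1 := Complex.sub_conj ((c - a) * conj (b - a))
  rw [map_mul, Complex.conj_conj, map_sub, map_sub, ← Complex.inv_eq_conj ha,
    ← Complex.inv_eq_conj hb, ← Complex.inv_eq_conj hc] at h1
  have h2 : (sd a b c : ℂ) * (2 * Complex.I)
      = ((2 * ((c - a) * (b⁻¹ - a⁻¹)).im : ℝ) : ℂ) * Complex.I := by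
    rw [sd, map_sub, Complex.inv_eq_conj ha, Complex.inv_eq_conj hb]
    push_cast
    ring
  rw [h2, ← h1]
  field_simp
  ring

lemma eq_or_eq_of_sd_eq_zero {a b c : ℂ} (ha : ‖a‖ = 1) (hb : ‖b‖ = 1) (hc : ‖c‖ = 1)
    (hab : a ≠ b) (h : sd a b c = 0) : c = a ∨ c = b := by
  have h1 := sd_eq ha hb hc
  rw [h, Complex.ofReal_zero, zero_mul, eq_comm, div_eq_zero_iff, neg_eq_zero, mul_eq_zero,
    mul_eq_zero, mul_eq_zero, mul_eq_zero] at h1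
  simp only [ne_zero_of_norm_eq_one ha, ne_zero_of_norm_eq_one hb, ne_zero_of_norm_eq_one hc,
    or_false, sub_eq_zero, hab, false_or] at h1
  exact h1.symm.imp id Eq.symm

lemma sd_mul_sd {a b c d : ℂ} (ha : ‖a‖ = 1) (hb : ‖b‖ = 1) (hc : ‖c‖ = 1) (hd : ‖d‖ = 1) :
    Complex.normSq (c - d) * (sd a b c * sd a b d)
      = Complex.normSq (a - b) * (sd c d a * sd c d b) := by
  have ha0 := ne_zero_of_norm_eq_one ha
  have hb0 := ne_zero_of_norm_eq_one hb
  have hc0 := ne_zero_of_norm_eq_one hc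
  have hd0 := ne_zero_of_norm_eq_one hd
  have hI : (2 * Complex.I) ≠ 0 := by simp
  have e1 := eq_div_of_mul_eq hI (sd_eq ha hb hc)
  have e2 := eq_div_of_mul_eq hI (sd_eq ha hb hd)
  have e3 := eq_div_of_mul_eq hI (sd_eq hc hd ha)
  have e4 := eq_div_of_mul_eq hI (sd_eq hc hd hb)
  apply Complex.ofReal_injective
  push_cast
  rw [Complex.normSq_eq_conj_mul_self, Complex.normSq_eq_conj_mul_self, map_sub, map_sub,
    ← Complex.inv_eq_conj ha, ← Complex.inv_eq_conj hb, ← Complex.inv_eq_conj hc,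
    ← Complex.inv_eq_conj hd, e1, e2, e3, e4]
  field_simp
  ring

lemma sd_mul_sd_pos {a b c d : ℂ} (ha : ‖a‖ = 1) (hb : ‖b‖ = 1) (hc : ‖c‖ = 1) (hd : ‖d‖ = 1)
    (hcd : c ≠ d) (h : 0 < sd a b c * sd a b d) : 0 < sd c d a * sd c d b := by
  have h1 := mul_pos (Complex.normSq_pos.2 (sub_ne_zero.2 hcd)) h
  rw [sd_mul_sd ha hb hc hd] at h1
  exact pos_of_mul_pos_right h1 (Complex.normSq_nonneg _)

lemma exists_sd_pos {a b : ℂ} (ha : ‖a‖ = 1) (hb : ‖b‖ = 1) (hab : a ≠ b) :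
    ∃ c : ℂ, ‖c‖ = 1 ∧ 0 < sd a b c := by
  have hn : 0 < ‖b - a‖ := norm_pos_iff.2 (sub_ne_zero.2 hab.symm)
  have hn0 : ((‖b - a‖ : ℝ) : ℂ) ≠ 0 := by exact_mod_cast hn.ne'
  refine ⟨Complex.I * (b - a) / ‖b - a‖, ?_, ?_⟩
  · rw [norm_div, norm_mul, Complex.norm_I, Complex.norm_real, norm_norm, one_mul,
      div_self hn.ne']
  · have h1 : (Complex.I * (b - a) / ‖b - a‖ - a) * conj (b - a)
        = Complex.I * ‖b - a‖ - (a * conj b - 1) := by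
      have e1 : (b - a) * conj (b - a) = (‖b - a‖ : ℂ) ^ 2 := Complex.mul_conj' _
      have e2 : a * conj a = 1 := by rw [Complex.mul_conj', ha]; simp
      calc _ = Complex.I * ((b - a) * conj (b - a)) / ‖b - a‖ - (a * conj b - a * conj a) := by
            rw [map_sub]; field_simp
        _ = _ := by rw [e1, e2]; field_simp
    have hre : ‖b - a‖ ^ 2 = 2 - 2 * (a * conj b).re := by
      rw [← Complex.normSq_eq_norm_sq, Complex.normSq_sub, Complex.normSq_eq_norm_sq,
        Complex.normSq_eq_norm_sq, ha, hb]
      simp only [Complex.mul_re, Complex.conj_re, Complex.conj_im]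
      ring
    have hsq : (a * conj b).re ^ 2 + (a * conj b).im ^ 2 = 1 := by
      have : ‖a * conj b‖ = 1 := by rw [norm_mul, ha, RCLike.norm_conj, hb, one_mul]
      rw [sq, sq, ← Complex.normSq_apply, Complex.normSq_eq_norm_sq, this, one_pow]
    rw [sd, h1]
    generalize a * conj b = w at hre hsq
    simp only [Complex.sub_im, Complex.mul_im, Complex.I_re, Complex.I_im, Complex.ofReal_re,
      Complex.ofReal_im, Complex.one_im]
    have hlt : w.im ^ 2 < ‖b - a‖ ^ 2 := by nlinarith [pow_pos hn 2]
    linarith [(abs_lt.1 (abs_lt_of_sq_lt_sq hlt hn.le)).2]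

lemma isPreconnected_sphere_diff {u : ℂ} (hu : ‖u‖ = 1) :
    IsPreconnected (sphere (0 : ℂ) 1 \ {u}) := by
  have hu0 := ne_zero_of_norm_eq_one hu
  convert (isPreconnected_Ioo (a := -Real.pi) (b := Real.pi)).image
    (fun θ : ℝ => -u * Complex.exp (θ * Complex.I)) (by fun_prop) using 1
  ext z
  constructor
  · rintro ⟨hz, hzu⟩
    have hw : ‖-z / u‖ = 1 := by
      rw [norm_div, norm_neg, hu, mem_sphere_zero_iff_norm.1 hz, div_one]
    have he := Complex.norm_mul_exp_arg_mul_I (-z / u)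
    rw [hw, Complex.ofReal_one, one_mul] at he
    refine ⟨(-z / u).arg, ⟨Complex.neg_pi_lt_arg _, lt_of_le_of_ne (Complex.arg_le_pi _) ?_⟩, ?_⟩
    · intro hpi
      rw [hpi, Complex.exp_pi_mul_I, neg_div, neg_inj, eq_comm, div_eq_one_iff_eq hu0] at he
      exact hzu he
    · simp only
      rw [he]
      field_simp
  · rintro ⟨θ, hθ, rfl⟩
    refine ⟨?_, fun h => ?_⟩
    · rw [mem_sphere_zero_iff_norm, norm_mul, norm_neg, hu, Complex.norm_exp_ofReal_mul_I, one_mul]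
    · have h1 : Complex.exp (θ * Complex.I) = -1 := by
        apply mul_left_cancel₀ (neg_ne_zero.2 hu0)
        simpa using h
      have h2 := congrArg Complex.arg h1
      rw [Complex.arg_exp_mul_I, toIocMod_eq_self _ |>.2, Complex.arg_neg_one] at h2
      · exact hθ.2.ne h2
      · exact ⟨hθ.1, by linarith [hθ.2]⟩

/-- A map of the unit circle onto the unit interval that behaves like a fold. -/
structure IsFold (τ : ℂ → ℝ) : Prop where
  cont : ContinuousOn τ (sphere 0 1)
  mem : ∀ u ∈ sphere (0 : ℂ) 1, τ u ∈ Icc (0 : ℝ) 1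
  surj : ∀ t ∈ Icc (0 : ℝ) 1, ∃ u ∈ sphere (0 : ℂ) 1, τ u = t
  not_const : ∀ ζ ∈ sphere (0 : ℂ) 1, ∀ r > 0, ∃ z ∈ sphere (0 : ℂ) 1, ‖z - ζ‖ < r ∧ τ z ≠ τ ζ
  le_of_lt : ∀ u ∈ sphere (0 : ℂ) 1, ∀ v ∈ sphere (0 : ℂ) 1, u ≠ v → τ u = τ v →
    ∀ x ∈ sphere (0 : ℂ) 1, ∀ y ∈ sphere (0 : ℂ) 1, 0 < sd u v x → sd u v y < 0 →
      τ x < τ u → τ u ≤ τ y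
  le_of_gt : ∀ u ∈ sphere (0 : ℂ) 1, ∀ v ∈ sphere (0 : ℂ) 1, u ≠ v → τ u = τ v →
    ∀ x ∈ sphere (0 : ℂ) 1, ∀ y ∈ sphere (0 : ℂ) 1, 0 < sd u v x → sd u v y < 0 →
      τ u < τ x → τ y ≤ τ u

namespace IsFold

variable {τ : ℂ → ℝ}

lemma exists_ne (h : IsFold τ) {u v : ℂ} (hu : u ∈ sphere (0 : ℂ) 1) (hv : v ∈ sphere (0 : ℂ) 1)
    (huv : u ≠ v) (t : ℝ) : ∃ x ∈ sphere (0 : ℂ) 1, 0 < sd u v x ∧ τ x ≠ t := by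
  by_contra! hcon
  obtain ⟨ζ, hζ, hpos⟩ := exists_sd_pos (mem_sphere_zero_iff_norm.1 hu)
    (mem_sphere_zero_iff_norm.1 hv) huv
  have hζ' := mem_sphere_zero_iff_norm.2 hζ
  obtain ⟨r, hr, hball⟩ := Metric.isOpen_iff.1
    (isOpen_lt continuous_const (continuous_sd u v)) ζ hpos
  obtain ⟨z, hz, hzr, hne⟩ := h.not_const ζ hζ' r hr
  exact hne ((hcon z hz (hball (mem_ball_iff_norm.2 hzr))).trans (hcon ζ hζ' hpos).symm)

lemma exists_ne' (h : IsFold τ) {u v : ℂ} (hu : u ∈ sphere (0 : ℂ) 1) (hv : v ∈ sphere (0 : ℂ) 1)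
    (huv : u ≠ v) (t : ℝ) : ∃ x ∈ sphere (0 : ℂ) 1, sd u v x < 0 ∧ τ x ≠ t := by
  obtain ⟨x, hx, hpos, hne⟩ := h.exists_ne hv hu huv.symm t
  exact ⟨x, hx, by rwa [sd_swap, neg_pos] at hpos, hne⟩

lemma eq_of_eq_zero (h : IsFold τ) {u v : ℂ} (hu : u ∈ sphere (0 : ℂ) 1)
    (hv : v ∈ sphere (0 : ℂ) 1) (hu0 : τ u = 0) (hv0 : τ v = 0) : u = v := by
  by_contra huv
  obtain ⟨x, hx, hpos, hx0⟩ := h.exists_ne hu hv huv 0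
  obtain ⟨y, hy, hneg, hy0⟩ := h.exists_ne' hu hv huv 0
  have h1 := h.le_of_gt u hu v hv huv (hu0.trans hv0.symm) x hx y hy hpos hneg
    (hu0 ▸ (h.mem x hx).1.lt_of_ne' hx0)
  exact hy0 (le_antisymm (hu0 ▸ h1) (h.mem y hy).1)

lemma eq_of_eq_one (h : IsFold τ) {u v : ℂ} (hu : u ∈ sphere (0 : ℂ) 1)
    (hv : v ∈ sphere (0 : ℂ) 1) (hu1 : τ u = 1) (hv1 : τ v = 1) : u = v := by
  by_contra huv
  obtain ⟨x, hx, hpos, hx1⟩ := h.exists_ne hu hv huv 1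
  obtain ⟨y, hy, hneg, hy1⟩ := h.exists_ne' hu hv huv 1
  have h1 := h.le_of_lt u hu v hv huv (hu1.trans hv1.symm) x hx y hy hpos hneg
    (hu1 ▸ (h.mem x hx).2.lt_of_ne hx1)
  exact hy1 (le_antisymm (h.mem y hy).2 (hu1 ▸ h1))

lemma not_sd_pos (h : IsFold τ) {u v a b : ℂ} (hu : u ∈ sphere (0 : ℂ) 1)
    (hv : v ∈ sphere (0 : ℂ) 1) (ha : a ∈ sphere (0 : ℂ) 1) (hb : b ∈ sphere (0 : ℂ) 1)
    (huv : u ≠ v) (hτ : τ u = τ v) (hau : τ a < τ u) (hub : τ u < τ b) (hpa : 0 < sd u v a) :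
    ¬ 0 < sd u v b := by
  intro hpb
  obtain ⟨y, hy, hneg, hne⟩ := h.exists_ne' hu hv huv (τ u)
  exact hne (le_antisymm (h.le_of_gt u hu v hv huv hτ b hb y hy hpb hneg hub)
    (h.le_of_lt u hu v hv huv hτ a ha y hy hpa hneg hau))

lemma eq_of_same_side (h : IsFold τ) {u v a b : ℂ} (hu : u ∈ sphere (0 : ℂ) 1)
    (hv : v ∈ sphere (0 : ℂ) 1) (ha : a ∈ sphere (0 : ℂ) 1) (hb : b ∈ sphere (0 : ℂ) 1)
    (hτ : τ u = τ v) (hau : τ a < τ u) (hub : τ u < τ b) (hs : 0 < sd a b u * sd a b v) :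
    u = v := by
  by_contra huv
  have h1 := sd_mul_sd_pos (mem_sphere_zero_iff_norm.1 ha) (mem_sphere_zero_iff_norm.1 hb)
    (mem_sphere_zero_iff_norm.1 hu) (mem_sphere_zero_iff_norm.1 hv) huv hs
  rcases mul_pos_iff.1 h1 with ⟨h2, h3⟩ | ⟨h2, h3⟩
  · exact h.not_sd_pos hu hv ha hb huv hτ hau hub h2 h3
  · rw [← neg_pos, ← sd_swap] at h2 h3
    exact h.not_sd_pos hv hu ha hb (Ne.symm huv) hτ.symm (hτ ▸ hau) (hτ ▸ hub) h2 h3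

lemma exists_ne_eq (h : IsFold τ) {u a b : ℂ} (hu : u ∈ sphere (0 : ℂ) 1)
    (ha : a ∈ sphere (0 : ℂ) 1) (hb : b ∈ sphere (0 : ℂ) 1) (hau : τ a < τ u) (hub : τ u < τ b) :
    ∃ v ∈ sphere (0 : ℂ) 1, v ≠ u ∧ τ v = τ u := by
  have hp := isPreconnected_sphere_diff (mem_sphere_zero_iff_norm.1 hu)
  obtain ⟨v, hv, hvt⟩ := hp.intermediate_value (f := τ) (a := a) (b := b)
    ⟨ha, fun h0 => hau.ne (congrArg τ h0)⟩ ⟨hb, fun h0 => hub.ne' (congrArg τ h0)⟩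
    (h.cont.mono sdiff_subset) ⟨hau.le, hub.le⟩
  exact ⟨v, hv.1, hv.2, hvt⟩

lemma exists_homeomorph (h : IsFold τ) :
    ∃ σ : sphere (0 : ℂ) 1 ≃ₜ sphere (0 : ℂ) 1, ∀ u, τ (σ u) = ((u : ℂ).re + 1) / 2 := by
  obtain ⟨a, ha, ha0⟩ := h.surj 0 (by simp)
  obtain ⟨b, hb, hb1⟩ := h.surj 1 (by simp)
  have hab : a ≠ b := by rintro rfl; rw [ha0] at hb1; exact zero_ne_one hb1
  set X := sphere (0 : ℂ) 1 with hX
  set s : X → ℝ := fun u => √(1 - (2 * τ u - 1) ^ 2) with hs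
  have hτc : Continuous fun u : X => τ u := continuousOn_iff_continuous_domRestrict.1 h.cont
  have hτc' : Continuous fun u : X => 2 * τ u - 1 := (hτc.const_mul 2).sub continuous_const
  have hsc : Continuous s := (continuous_const.sub (hτc'.pow 2)).sqrt
  have hzero : ∀ u : X, sd a b u = 0 → s u = 0 := by
    intro u hu
    rcases eq_or_eq_of_sd_eq_zero (mem_sphere_zero_iff_norm.1 ha) (mem_sphere_zero_iff_norm.1 hb)
      (mem_sphere_zero_iff_norm.1 u.2) hab hu with hu | hu
    · simp [hs, hu, ha0]
    · simp [hs, hu, hb1]; norm_num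
  set m : X → ℝ := fun u => if sd a b u ≤ 0 then s u else -s u with hm
  have hmc : Continuous m := by
    refine Continuous.if_le hsc hsc.neg ((continuous_sd a b).comp continuous_subtype_val)
      continuous_const fun u hu => ?_
    rw [hzero u hu, neg_zero]
  have hs2 : ∀ u : X, s u ^ 2 = 1 - (2 * τ u - 1) ^ 2 := fun u => Real.sq_sqrt (by
    nlinarith [(h.mem u u.2).1, (h.mem u u.2).2])
  have hm2 : ∀ u, m u ^ 2 = 1 - (2 * τ u - 1) ^ 2 := by
    intro u
    simp only [hm]
    split_ifs <;> simp only [neg_sq, hs2]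
  have hρX : ∀ u : X, (⟨2 * τ u - 1, m u⟩ : ℂ) ∈ X := fun u => by
    rw [mem_sphere_zero_iff_norm, ← pow_eq_one_iff_of_nonneg (norm_nonneg _) two_ne_zero,
      ← Complex.normSq_eq_norm_sq, Complex.normSq_mk, ← sq, ← sq, hm2]
    ring
  set ρ : X → X := fun u => ⟨⟨2 * τ u - 1, m u⟩, hρX u⟩ with hρ
  have hρc : Continuous ρ := by
    refine Continuous.subtype_mk ?_ _
    have : (fun u : X => (⟨2 * τ u - 1, m u⟩ : ℂ))
        = fun u : X => ((2 * τ u - 1 : ℝ) : ℂ) + (m u : ℝ) * Complex.I := by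
      funext u; exact Complex.mk_eq_add_mul_I _ _
    rw [this]
    exact (Complex.continuous_ofReal.comp hτc').add
      ((Complex.continuous_ofReal.comp hmc).mul continuous_const)
  have hinj : Function.Injective ρ := by
    intro u v huv
    have h1 := congrArg Subtype.val huv
    obtain ⟨h2, h3⟩ := Complex.ext_iff.1 h1
    simp only [hρ] at h2 h3
    have hτ : τ u = τ v := by linarith
    apply Subtype.ext
    rcases (h.mem u u.2).1.eq_or_lt with h0 | h0
    · exact h.eq_of_eq_zero u.2 v.2 h0.symm (by rw [← hτ, ← h0])
    rcases (h.mem u u.2).2.eq_or_lt with h4 | h4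
    · exact h.eq_of_eq_one u.2 v.2 h4 (by rw [← hτ, ← h4])
    refine h.eq_of_same_side u.2 v.2 ha hb hτ (by rwa [ha0]) (by rwa [hb1]) ?_
    have hspos : 0 < s u := Real.sqrt_pos.2 (by nlinarith)
    have hsuv : s v = s u := by simp only [hs, hτ]
    have hu0 : sd a b u ≠ 0 := fun h5 => hspos.ne' (hzero u h5)
    have hv0 : sd a b v ≠ 0 := fun h5 => hspos.ne' (hsuv ▸ hzero v h5)
    simp only [hm, hsuv] at h3
    split_ifs at h3 with h5 h6 h6
    · exact mul_pos_of_neg_of_neg (lt_of_le_of_ne h5 hu0) (lt_of_le_of_ne h6 hv0)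
    · linarith
    · linarith
    · exact mul_pos (not_le.1 h5) (not_le.1 h6)
  have hsurj : Function.Surjective ρ := by
    rintro ⟨w, hw⟩
    have hw2 : w.re ^ 2 + w.im ^ 2 = 1 := by
      rw [sq, sq, ← Complex.normSq_apply, Complex.normSq_eq_norm_sq,
        mem_sphere_zero_iff_norm.1 hw, one_pow]
    obtain ⟨u, hu, hut⟩ := h.surj ((w.re + 1) / 2) ⟨by nlinarith, by nlinarith⟩
    have key : ∀ v : X, τ v = (w.re + 1) / 2 → m v = w.im ∨ m v = -w.im := by
      intro v hv
      rw [← sq_eq_sq_iff_eq_or_eq_neg, hm2, hv]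
      linarith
    have fin : ∀ v : X, τ v = (w.re + 1) / 2 → m v = w.im → ρ v = ⟨w, hw⟩ := by
      intro v hv hmv
      apply Subtype.ext
      apply Complex.ext
      · simp only [hρ, hv]; ring
      · exact hmv
    by_cases him : w.im = 0
    · refine ⟨⟨u, hu⟩, fin ⟨u, hu⟩ hut ?_⟩
      rcases key ⟨u, hu⟩ hut with h1 | h1
      · exact h1
      · rw [h1, him, neg_zero]
    have hlt : 0 < w.im ^ 2 := by positivity
    obtain ⟨v, hv, hvu, hvt⟩ := h.exists_ne_eq hu ha hb (by rw [ha0, hut]; nlinarith)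
      (by rw [hb1, hut]; nlinarith)
    rcases key ⟨u, hu⟩ hut with h1 | h1
    · exact ⟨_, fin _ hut h1⟩
    rcases key ⟨v, hv⟩ (hvt.trans hut) with h2 | h2
    · exact ⟨_, fin _ (hvt.trans hut) h2⟩
    exfalso
    refine hvu (congrArg Subtype.val (@hinj ⟨v, hv⟩ ⟨u, hu⟩ (Subtype.ext (Complex.ext ?_ ?_))))
    · simp only [hρ, hvt]
    · exact h2.trans h1.symm
  have hXc : CompactSpace X := isCompact_iff_compactSpace.1 (isCompact_sphere _ _)
  set e := Equiv.ofBijective ρ ⟨hinj, hsurj⟩ with he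
  refine ⟨(Continuous.homeoOfEquivCompactToT2 (f := e) hρc).symm, fun w => ?_⟩
  have h1 : ρ (e.symm w) = w := e.apply_symm_apply w
  have h2 := congrArg (fun x : X => (x : ℂ).re) h1
  simp only [hρ] at h2
  change τ (e.symm w) = _
  linarith

end IsFold

end PlaneArc

namespace PlaneArc

open Filter Topology ComplexConjugate

namespace IsBoundaryExt

variable {α : ℝ → ℂ} {φ : ℂ → ℂ}

lemma exists_joinedOff (h : IsBoundaryExt α φ) {J N : Set ℂ} (hJ : IsClosed J) {x : ℂ}
    (hx : x ∈ sphere (0 : ℂ) 1) (hxJ : φ x ∉ J) (hN : N ∈ 𝓝 x) :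
    ∃ z ∈ ball (0 : ℂ) 1 \ {0}, z ∈ N ∧ JoinedOff J (φ z) (φ x) := by
  have hx' := sphere_subset_closedBall_diff hx
  have h1 : ∀ᶠ z in 𝓝[closedBall 0 1 \ {0}] x, φ z ∉ J :=
    (h.cont x hx').eventually (hJ.isOpen_compl.mem_nhds hxJ)
  obtain ⟨ε, hε, hball⟩ := Metric.mem_nhdsWithin_iff.1 h1
  set δ := min ε 1 with hδ
  have hδ0 : 0 < δ := lt_min hε one_pos
  have h0 : ∀ z ∈ closedBall (0 : ℂ) 1 ∩ ball x δ, z ∈ closedBall (0 : ℂ) 1 \ {0} := by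
    rintro z ⟨hz, hzx⟩
    refine ⟨hz, ?_⟩
    rintro rfl
    have h2 := mem_ball'.1 hzx
    rw [mem_sphere.1 hx] at h2
    exact h2.not_ge (min_le_right _ _)
  obtain ⟨z, ⟨hzN, hzx⟩, hz⟩ := mem_closure_iff_nhds.1 (closedBall_diff_subset_closure hx') _
    (inter_mem hN (ball_mem_nhds x hδ0))
  refine ⟨z, hz, hzN, φ '' (closedBall 0 1 ∩ ball x δ), ?_, ?_, ?_, ?_⟩
  · exact (((convex_closedBall _ _).inter (convex_ball _ _)).isPreconnected).image _
      (h.cont.mono h0)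
  · rintro _ ⟨w, hw, rfl⟩
    exact hball ⟨ball_subset_ball (min_le_left _ _) hw.2, h0 w hw⟩
  · exact ⟨z, ⟨ball_subset_closedBall hz.1, hzx⟩, rfl⟩
  · exact ⟨x, ⟨hx'.1, mem_ball_self hδ0⟩, rfl⟩

lemma not_exists_isPreconnected (h : IsBoundaryExt α φ) {u v x y : ℂ}
    (hu : u ∈ sphere (0 : ℂ) 1) (hv : v ∈ sphere (0 : ℂ) 1) (huv : u ≠ v) (hφ : φ u = φ v)
    (hx : x ∈ sphere (0 : ℂ) 1) (hy : y ∈ sphere (0 : ℂ) 1) (hpos : 0 < sd u v x)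
    (hneg : sd u v y < 0) {C : Set ℂ} (hC : IsPreconnected C) (hCA : C ⊆ α '' Icc 0 1)
    (huC : φ u ∉ C) (hxC : φ x ∈ C) (hyC : φ y ∈ C) : False := by
  set l : ℂ → ℝ := fun z => sd u v z + (|sd u v 0| + 1) * (1 - ‖z‖ ^ 2) with hl
  have hlc : Continuous l := (continuous_sd u v).add
    (continuous_const.mul (continuous_const.sub (continuous_norm.pow 2)))
  have hl0 : 0 < l 0 := by
    simp only [hl, norm_zero]
    linarith [neg_abs_le (sd u v 0)]
  have hls : ∀ z ∈ sphere (0 : ℂ) 1, l z = sd u v z := by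
    intro z hz
    simp only [hl, mem_sphere_zero_iff_norm.1 hz]
    ring
  set Z := closedBall (0 : ℂ) 1 ∩ {z | l z = 0} with hZ
  have hZc : IsCompact Z :=
    (isCompact_closedBall _ _).inter_right (isClosed_eq hlc continuous_const)
  have hZs : Z ⊆ closedBall 0 1 \ {0} := by
    rintro z ⟨hz, hz0⟩
    refine ⟨hz, ?_⟩
    rintro rfl
    exact hl0.ne' hz0
  have hJ : IsCompact (φ '' Z) := hZc.image_of_continuousOn (h.cont.mono hZs)
  have huZ : u ∈ Z := ⟨sphere_subset_closedBall hu, (hls u hu).trans (sd_left _ _)⟩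
  have huA : φ u ∈ α '' Icc 0 1 := h.image_sphere ▸ mem_image_of_mem φ hu
  have hAJ : α '' Icc 0 1 ∩ φ '' Z = {φ u} := by
    refine Subset.antisymm ?_ (singleton_subset_iff.2 ⟨huA, mem_image_of_mem φ huZ⟩)
    rintro _ ⟨hzA, z, hz, rfl⟩
    rcases mem_ball_diff_or_mem_sphere (hZs hz) with hz1 | hz1
    · exact absurd hzA (h.notMem hz1)
    · have h1 : sd u v z = 0 := (hls z hz1).symm.trans hz.2
      rcases eq_or_eq_of_sd_eq_zero (mem_sphere_zero_iff_norm.1 hu)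
        (mem_sphere_zero_iff_norm.1 hv) (mem_sphere_zero_iff_norm.1 hz1) huv h1 with rfl | rfl
      · rfl
      · exact hφ.symm
  have hCJ : C ⊆ (φ '' Z)ᶜ := by
    intro c hc hcJ
    have h1 : c ∈ ({φ u} : Set ℂ) := hAJ ▸ ⟨hCA hc, hcJ⟩
    rw [mem_singleton_iff] at h1
    exact huC (h1 ▸ hc)
  obtain ⟨z, hz, hzN, hjz⟩ := h.exists_joinedOff hJ.isClosed hx (hCJ hxC)
    ((isOpen_lt continuous_const hlc).mem_nhds (show 0 < l x by rwa [hls x hx]))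
  obtain ⟨w, hw, hwN, hjw⟩ := h.exists_joinedOff hJ.isClosed hy (hCJ hyC)
    ((isOpen_lt hlc continuous_const).mem_nhds (show l y < 0 by rwa [hls y hy]))
  refine h.not_joinedOff hJ (by rw [hAJ]; exact isPreconnected_singleton)
    (isOpen_puncturedBall.inter (isOpen_lt continuous_const hlc))
    (isOpen_puncturedBall.inter (isOpen_lt hlc continuous_const)) inter_subset_left
    inter_subset_left ?_ ?_ ⟨hz, hzN⟩ ⟨hw, hwN⟩
    (hjz.trans (JoinedOff.trans ⟨C, hC, hCJ, hxC, hyC⟩ hjw.symm))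
  · exact disjoint_left.2 fun a ha hb => lt_asymm (show 0 < l a from ha.2) hb.2
  · intro a ha haJ
    rcases lt_trichotomy (l a) 0 with h1 | h1 | h1
    · exact .inr ⟨ha, h1⟩
    · exact absurd ⟨a, ⟨ball_subset_closedBall ha.1, h1⟩, rfl⟩ haJ
    · exact .inl ⟨ha, h1⟩

lemma exists_isFold (h : IsBoundaryExt α φ) :
    ∃ τ : ℂ → ℝ, IsFold τ ∧ ∀ u ∈ sphere (0 : ℂ) 1, φ u = α (τ u) := by
  obtain ⟨β, hβc, hβ⟩ := h.arc.exists_inverse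
  have hmaps : MapsTo φ (sphere 0 1) (α '' Icc 0 1) := by
    rw [← h.image_sphere]; exact mapsTo_image _ _
  have hmem : ∀ u ∈ sphere (0 : ℂ) 1, β (φ u) ∈ Icc (0 : ℝ) 1 := by
    intro u hu
    obtain ⟨t, ht, htu⟩ := hmaps hu
    rw [← htu, hβ t ht]
    exact ht
  have heq : ∀ u ∈ sphere (0 : ℂ) 1, φ u = α (β (φ u)) := by
    intro u hu
    obtain ⟨t, ht, htu⟩ := hmaps hu
    rw [← htu, hβ t ht]
  have key : ∀ S : Set ℝ, S.OrdConnected → S ⊆ Icc 0 1 → ∀ u ∈ sphere (0 : ℂ) 1,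
      ∀ v ∈ sphere (0 : ℂ) 1, u ≠ v → β (φ u) = β (φ v) → ∀ x ∈ sphere (0 : ℂ) 1,
      ∀ y ∈ sphere (0 : ℂ) 1, 0 < sd u v x → sd u v y < 0 → β (φ u) ∉ S → β (φ x) ∈ S →
      β (φ y) ∉ S := by
    intro S hS hSI u hu v hv huv hφ x hx y hy hpos hneg huS hxS hyS
    refine h.not_exists_isPreconnected hu hv huv (by rw [heq u hu, heq v hv, hφ]) hx hy hpos hneg
      (C := α '' S) (hS.isPreconnected.image _ h.arc.cont.continuousOn) (image_mono hSI) ?_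
      ⟨_, hxS, (heq x hx).symm⟩ ⟨_, hyS, (heq y hy).symm⟩
    rintro ⟨s, hs, hsu⟩
    rw [← hsu, hβ s (hSI hs)] at huS
    exact huS hs
  refine ⟨fun z => β (φ z), ⟨?_, hmem, ?_, ?_, ?_, ?_⟩, heq⟩
  · exact hβc.comp (h.cont.mono sphere_subset_closedBall_diff) hmaps
  · intro t ht
    have h1 : α t ∈ φ '' sphere 0 1 := h.image_sphere ▸ mem_image_of_mem α ht
    obtain ⟨u, hu, hut⟩ := h1
    exact ⟨u, hu, by simp only [hut, hβ t ht]⟩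
  · intro ζ hζ r hr
    obtain ⟨z, hz, hzr, hne⟩ := h.not_const ζ hζ r hr
    exact ⟨z, hz, hzr, fun h1 => hne (by rw [heq z hz, heq ζ hζ]; exact congrArg α h1)⟩
  · intro u hu v hv huv hφ x hx y hy hpos hneg hlt
    by_contra! hcon
    exact key (Ico 0 (β (φ u))) ordConnected_Ico
      (Ico_subset_Icc_self.trans (Icc_subset_Icc_right (hmem u hu).2)) u hu v hv huv hφ x hx y hy
      hpos hneg (fun h1 => lt_irrefl _ h1.2) ⟨(hmem x hx).1, hlt⟩ ⟨(hmem y hy).1, hcon⟩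
  · intro u hu v hv huv hφ x hx y hy hpos hneg hlt
    by_contra! hcon
    exact key (Ioc (β (φ u)) 1) ordConnected_Ioc
      (Ioc_subset_Icc_self.trans (Icc_subset_Icc_left (hmem u hu).1)) u hu v hv huv hφ x hx y hy
      hpos hneg (fun h1 => lt_irrefl _ h1.1) ⟨hlt, (hmem x hx).2⟩ ⟨hcon, (hmem y hy).2⟩

end IsBoundaryExt

end PlaneArc

namespace PlaneArc

open Filter Topology

lemma exists_homeomorph_comp_eq {X Y Z : Type*} [TopologicalSpace X] [TopologicalSpace Y]
    [TopologicalSpace Z] {f : X → Y} {g : X → Z} (hf : IsQuotientMap f) (hg : IsQuotientMap g)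
    (hfg : ∀ a b, f a = f b ↔ g a = g b) : ∃ e : Y ≃ₜ Z, ∀ x, e (f x) = g x := by
  have h1 : ∀ x, g (Function.surjInv hf.surjective (f x)) = g x := fun x =>
    (hfg _ _).1 (Function.surjInv_eq hf.surjective _)
  have h2 : ∀ x, f (Function.surjInv hg.surjective (g x)) = f x := fun x =>
    (hfg _ _).2 (Function.surjInv_eq hg.surjective _)
  refine ⟨⟨⟨fun y => g (Function.surjInv hf.surjective y),
    fun z => f (Function.surjInv hg.surjective z), fun y => ?_, fun z => ?_⟩, ?_, ?_⟩, h1⟩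
  · obtain ⟨x, rfl⟩ := hf.surjective y
    simp only [h1, h2]
  · obtain ⟨x, rfl⟩ := hg.surjective z
    simp only [h1, h2]
  · refine hf.continuous_iff.2 (hg.continuous.congr fun x => ?_)
    exact (h1 x).symm
  · refine hg.continuous_iff.2 (hf.continuous.congr fun x => ?_)
    exact (h2 x).symm

/-- The plane is a quotient of a half-open annulus, whose boundary circle is folded onto the arc. -/
lemma IsArcMap.exists_isQuotientMap {α : ℝ → ℂ} (hα : IsArcMap α) :
    ∃ P : sphere (0 : ℂ) 1 × Ioc (0 : ℝ) 1 → ℂ, IsQuotientMap P ∧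
      (∀ x y, P x = P y ↔ x = y ∨
        ((x.2 : ℝ) = 1 ∧ (y.2 : ℝ) = 1 ∧ (x.1 : ℂ).re = (y.1 : ℂ).re)) ∧
      P '' {x | (x.2 : ℝ) = 1} = α '' Icc 0 1 := by
  obtain ⟨φ, hφ⟩ := hα.exists_isBoundaryExt
  obtain ⟨τ, hτ, hφτ⟩ := hφ.exists_isFold
  obtain ⟨σ, hσ⟩ := hτ.exists_homeomorph
  set p : sphere (0 : ℂ) 1 × Ioc (0 : ℝ) 1 → ℂ := fun x => ((x.2 : ℝ) : ℂ) * (σ x.1 : ℂ) with hp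
  have hpc : Continuous p :=
    (Complex.continuous_ofReal.comp (continuous_subtype_val.comp continuous_snd)).mul
      (continuous_subtype_val.comp (σ.continuous.comp continuous_fst))
  have hnorm : ∀ x, ‖p x‖ = x.2 := fun x => by
    simp only [hp]
    rw [norm_mul, mem_sphere_zero_iff_norm.1 (σ x.1).2, mul_one, Complex.norm_real,
      Real.norm_of_nonneg x.2.2.1.le]
  have hpD : ∀ x, p x ∈ closedBall (0 : ℂ) 1 \ {0} := fun x =>
    ⟨mem_closedBall_zero_iff.2 ((hnorm x).trans_le x.2.2.2),
      norm_ne_zero_iff.1 ((hnorm x).trans_ne x.2.2.1.ne')⟩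
  have hpinj : ∀ x y, p x = p y → x = y := by
    intro x y hxy
    have h2 : (x.2 : ℝ) = y.2 := by rw [← hnorm, ← hnorm, hxy]
    have h1 : (σ x.1 : ℂ) = σ y.1 := by
      simp only [hp, h2] at hxy
      exact mul_left_cancel₀ (Complex.ofReal_ne_zero.2 y.2.2.1.ne') hxy
    exact Prod.ext (σ.injective (Subtype.ext h1)) (Subtype.ext h2)
  have hpone : ∀ x, (x.2 : ℝ) = 1 → p x = σ x.1 := fun x hx => by
    simp only [hp, hx, Complex.ofReal_one, one_mul]
  have hpball : ∀ x, (x.2 : ℝ) ≠ 1 → p x ∈ ball (0 : ℂ) 1 \ {0} := fun x hx =>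
    ⟨mem_ball_zero_iff.2 ((hnorm x).trans_lt (x.2.2.2.lt_of_ne hx)), (hpD x).2⟩
  have hpsurj : ∀ z ∈ closedBall (0 : ℂ) 1 \ {0}, ∃ x, p x = z := by
    rintro z ⟨hz, hz0⟩
    have hn : 0 < ‖z‖ := norm_pos_iff.2 hz0
    have hn0 : (‖z‖ : ℂ) ≠ 0 := Complex.ofReal_ne_zero.2 hn.ne'
    refine ⟨(σ.symm ⟨z / ‖z‖, ?_⟩, ⟨‖z‖, hn, mem_closedBall_zero_iff.1 hz⟩), ?_⟩
    · rw [mem_sphere_zero_iff_norm, norm_div, Complex.norm_real, norm_norm, div_self hn.ne']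
    · simp only [hp, Homeomorph.apply_symm_apply]
      field_simp
  have hA : ∀ x, (x.2 : ℝ) = 1 → φ (p x) = α (((x.1 : ℂ).re + 1) / 2) := fun x hx => by
    rw [hpone x hx, hφτ _ (σ x.1).2, hσ]
  have hmem : ∀ x : sphere (0 : ℂ) 1 × Ioc (0 : ℝ) 1,
      ((x.1 : ℂ).re + 1) / 2 ∈ Icc (0 : ℝ) 1 := fun x => hσ x.1 ▸ hτ.mem _ (σ x.1).2
  have hPc : Continuous (φ ∘ p) := hφ.cont.comp_continuous hpc hpD
  have himg : (φ ∘ p) '' {x | (x.2 : ℝ) = 1} = α '' Icc 0 1 := by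
    apply Subset.antisymm
    · rintro _ ⟨x, hx, rfl⟩
      exact ⟨_, hmem x, (hA x hx).symm⟩
    · rw [← hφ.image_sphere]
      rintro _ ⟨z, hz, rfl⟩
      obtain ⟨x, rfl⟩ := hpsurj z (sphere_subset_closedBall_diff hz)
      exact ⟨x, (hnorm x).symm.trans (mem_sphere_zero_iff_norm.1 hz), rfl⟩
  have hsurj : Function.Surjective (φ ∘ p) := by
    intro w
    by_cases hw : w ∈ α '' Icc 0 1
    · rw [← himg] at hw
      obtain ⟨x, -, hx⟩ := hw
      exact ⟨x, hx⟩
    · have h1 : w ∈ φ '' (ball 0 1 \ {0}) := hφ.image ▸ hw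
      obtain ⟨z, hz, rfl⟩ := h1
      obtain ⟨x, rfl⟩ := hpsurj z (ball_diff_subset hz)
      exact ⟨x, rfl⟩
  have hproper : IsProperMap (φ ∘ p) := by
    refine isProperMap_iff_isCompact_preimage.2 ⟨hPc, fun K hK => ?_⟩
    have h1 : ∀ᶠ z in 𝓝[≠] (0 : ℂ), φ z ∈ Kᶜ :=
      hφ.tendsto (Bornology.isBounded_def.1 hK.isBounded)
    obtain ⟨s, hs, hball⟩ := Metric.mem_nhdsWithin_iff.1 h1
    have hcs : CompactSpace (sphere (0 : ℂ) 1) :=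
      isCompact_iff_compactSpace.1 (isCompact_sphere _ _)
    have h2 : IsCompact ((Subtype.val : Ioc (0 : ℝ) 1 → ℝ) ⁻¹' Icc s 1) := by
      refine (IsInducing.subtypeVal.isCompact_preimage_iff ?_).2 isCompact_Icc
      rw [Subtype.range_coe]
      exact fun t ht => ⟨hs.trans_le ht.1, ht.2⟩
    refine (isCompact_univ.prod h2).of_isClosed_subset (hK.isClosed.preimage hPc) ?_
    intro x hx
    refine ⟨mem_univ _, ?_, x.2.2.2⟩
    by_contra! hlt
    exact hball ⟨mem_ball_zero_iff.2 ((hnorm x).trans_lt hlt), (hpD x).2⟩ hx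
  have hnotMem : ∀ x, (x.2 : ℝ) ≠ 1 → φ (p x) ∉ α '' Icc 0 1 := fun x hx =>
    hφ.notMem (hpball x hx)
  refine ⟨φ ∘ p, hproper.isClosedMap.isQuotientMap hPc hsurj, fun x y => ⟨fun hxy => ?_, ?_⟩,
    himg⟩
  · simp only [Function.comp_apply] at hxy
    by_cases hx : (x.2 : ℝ) = 1 <;> by_cases hy : (y.2 : ℝ) = 1
    · rw [hA x hx, hA y hy] at hxy
      have := hα.inj (hmem x) (hmem y) hxy
      exact .inr ⟨hx, hy, by linarith⟩
    · exact absurd ⟨_, hmem x, (hA x hx).symm.trans hxy⟩ (hnotMem y hy)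
    · exact absurd ⟨_, hmem y, (hA y hy).symm.trans hxy.symm⟩ (hnotMem x hx)
    · exact .inl (hpinj x y (hφ.inj (hpball x hx) (hpball y hy) hxy))
  · rintro (rfl | ⟨hx, hy, hre⟩)
    · rfl
    · simp only [Function.comp_apply]
      rw [hA x hx, hA y hy, hre]

/-- Any two arcs in the plane are ambiently homeomorphic. -/
lemma IsArcMap.exists_homeomorph {α₁ α₂ : ℝ → ℂ} (h₁ : IsArcMap α₁) (h₂ : IsArcMap α₂) :
    ∃ e : ℂ ≃ₜ ℂ, e '' (α₁ '' Icc 0 1) = α₂ '' Icc 0 1 := by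
  obtain ⟨P₁, hq₁, hf₁, hi₁⟩ := h₁.exists_isQuotientMap
  obtain ⟨P₂, hq₂, hf₂, hi₂⟩ := h₂.exists_isQuotientMap
  obtain ⟨e, he⟩ := exists_homeomorph_comp_eq hq₁ hq₂ fun a b => (hf₁ a b).trans (hf₂ a b).symm
  refine ⟨e, ?_⟩
  rw [← hi₁, ← hi₂, image_image]
  exact image_congr fun x _ => he x

end PlaneArc

/-- there are no wild arcs in the plane: every Jordan arc in `ℝ²` can
be mapped onto the segment `[0,1] × {0}` by a self-homeomorphism of `ℝ²`. -/
theorem no_wild_arcs_in_plane (A : Set (ℝ × ℝ)) (hA : IsJordanArc A) :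
    ∃ h : (ℝ × ℝ) ≃ₜ (ℝ × ℝ), h '' A = (Set.Icc (0:ℝ) 1) ×ˢ ({0} : Set ℝ) := by
  obtain ⟨g⟩ := hA
  let E : ℂ ≃ₜ ℝ × ℝ := Complex.equivRealProdCLM.toHomeomorph
  have hg : Continuous fun t => E.symm (g t) :=
    E.symm.continuous.comp (continuous_subtype_val.comp g.continuous)
  have hα : ∀ t : Icc (0 : ℝ) 1,
      IccExtend zero_le_one (fun t => E.symm (g t)) t = E.symm (g t) :=
    IccExtend_val zero_le_one _
  have h₁ : PlaneArc.IsArcMap (IccExtend zero_le_one fun t => E.symm (g t)) := by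
    refine ⟨hg.Icc_extend', fun s hs t ht hst => ?_⟩
    have h1 := (hα ⟨s, hs⟩).symm.trans (hst.trans (hα ⟨t, ht⟩))
    exact congrArg Subtype.val (g.injective (Subtype.ext (E.symm.injective h1)))
  have h₂ : PlaneArc.IsArcMap fun t : ℝ => (t : ℂ) :=
    ⟨Complex.continuous_ofReal, Complex.ofReal_injective.injOn⟩
  have hA₁ : IccExtend zero_le_one (fun t => E.symm (g t)) '' Icc 0 1 = E.symm '' A := by
    ext z
    constructor
    · rintro ⟨t, ht, rfl⟩
      exact ⟨g ⟨t, ht⟩, (g ⟨t, ht⟩).2, (hα ⟨t, ht⟩).symm⟩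
    · rintro ⟨a, ha, rfl⟩
      exact ⟨g.symm ⟨a, ha⟩, (g.symm ⟨a, ha⟩).2, by rw [hα, g.apply_symm_apply]⟩
  obtain ⟨e, he⟩ := h₁.exists_homeomorph h₂
  refine ⟨(E.symm.trans e).trans E, ?_⟩
  rw [hA₁] at he
  have h3 : ((E.symm.trans e).trans E) '' A = E '' (e '' (E.symm '' A)) := by
    simp only [image_image]
    rfl
  rw [h3, he, image_image]
  ext ⟨x, y⟩
  constructor
  · rintro ⟨t, ht, h4⟩
    obtain ⟨rfl, rfl⟩ := Prod.mk.inj h4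
    exact ⟨ht, rfl⟩
  · rintro ⟨hx, hy⟩
    obtain rfl : y = 0 := hy
    exact ⟨x, hx, rfl⟩
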